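/- Let $k > 0$ and $0 < R_1 < R_2$. Then $k^2$ is not a Maxwell eigenvalue in the spherical shell $B_{R_2} \setminus \overline{B_{R_1}}$ if and only if for every integer $n \geq 1$ both determinants $\det\begin{pmatrix} j_n(kR_1) & y_n(kR_1) \\ j_n(kR_2) & y_n(kR_2) \end{pmatrix}$ and $\det\begin{pmatrix} j_n(kR_1)+kR_1 j_n'(kR_1) & y_n(kR_1)+kR_1 y_n'(kR_1) \\ j_n(kR_2)+kR_2 j_n'(kR_2) & y_n(kR_2)+kR_2 y_n'(kR_2) \end{pmatrix}$ are nonzero, where $j_n$ and $y_n$ are the spherical Bessel and spherical Neumann functions of order $n$. -/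

import Mathlib

open Complex

/-- Partial derivative of a complex-valued function on `ℝ³` in the `i`-th coordinate
direction. -/
noncomputable def pd (i : Fin 3) (f : EuclideanSpace ℝ (Fin 3) → ℂ)
    (x : EuclideanSpace ℝ (Fin 3)) : ℂ :=
  fderiv ℝ f x (EuclideanSpace.single i 1)

/-- The curl of a complex vector field on `ℝ³`. -/
noncomputable def curl (F : EuclideanSpace ℝ (Fin 3) → Fin 3 → ℂ)
    (x : EuclideanSpace ℝ (Fin 3)) : Fin 3 → ℂ :=
  ![pd 1 (fun z => F z 2) x - pd 2 (fun z => F z 1) x,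
    pd 2 (fun z => F z 0) x - pd 0 (fun z => F z 2) x,
    pd 0 (fun z => F z 1) x - pd 1 (fun z => F z 0) x]

/-- Cross product of complex 3-vectors. -/
def crossC (a b : Fin 3 → ℂ) : Fin 3 → ℂ :=
  ![a 1 * b 2 - a 2 * b 1, a 2 * b 0 - a 0 * b 2, a 0 * b 1 - a 1 * b 0]

/-- The open spherical shell `B_{R₂} \ closure B_{R₁}`. -/
def shell (R1 R2 : ℝ) : Set (EuclideanSpace ℝ (Fin 3)) :=
  Metric.ball 0 R2 \ Metric.closedBall 0 R1

/-- `k²` is a Maxwell eigenvalue in the shell `B_{R₂} \ closure B_{R₁}`: there is a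
nontrivial solution `(E, H)` of `curl E - i k H = 0`, `curl H + i k E = 0` in the shell
with `ν × E = 0` on both boundary spheres. -/
def IsMaxwellEigenvalue (k R1 R2 : ℝ) : Prop :=
  ∃ E H : EuclideanSpace ℝ (Fin 3) → Fin 3 → ℂ,
    ContinuousOn E (closure (shell R1 R2)) ∧
    ContinuousOn H (closure (shell R1 R2)) ∧
    (∀ x ∈ shell R1 R2, ∀ i : Fin 3, DifferentiableAt ℝ (fun z => E z i) x) ∧
    (∀ x ∈ shell R1 R2, ∀ i : Fin 3, DifferentiableAt ℝ (fun z => H z i) x) ∧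
    (∀ x ∈ shell R1 R2, curl E x = fun i => Complex.I * k * H x i) ∧
    (∀ x ∈ shell R1 R2, curl H x = fun i => -(Complex.I * k) * E x i) ∧
    (∀ x : EuclideanSpace ℝ (Fin 3), ‖x‖ = R1 ∨ ‖x‖ = R2 →
      crossC (fun i => (x i : ℂ)) (E x) = 0) ∧
    ¬ (∀ x ∈ shell R1 R2, E x = 0 ∧ H x = 0)

/-- The spherical Bessel functions of the first kind `jₙ`. -/
noncomputable def sphJ : ℕ → ℝ → ℝ
  | 0 => fun t => Real.sin t / t
  | 1 => fun t => Real.sin t / t ^ 2 - Real.cos t / t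
  | (n + 2) => fun t => ((2 * (n + 1) + 1 : ℝ) / t) * sphJ (n + 1) t - sphJ n t

/-- The spherical Bessel functions of the second kind (spherical Neumann functions) `yₙ`. -/
noncomputable def sphY : ℕ → ℝ → ℝ
  | 0 => fun t => -(Real.cos t / t)
  | 1 => fun t => -(Real.cos t / t ^ 2) - Real.sin t / t
  | (n + 2) => fun t => ((2 * (n + 1) + 1 : ℝ) / t) * sphY (n + 1) t - sphY n t

theorem sphJ_rec (n : ℕ) (t : ℝ) :
    sphJ (n + 2) t = (2 * (n + 1) + 1 : ℝ) / t * sphJ (n + 1) t - sphJ n t := by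
  rw [sphJ]

theorem sphY_rec (n : ℕ) (t : ℝ) :
    sphY (n + 2) t = (2 * (n + 1) + 1 : ℝ) / t * sphY (n + 1) t - sphY n t := by
  rw [sphY]

/-- A sequence satisfying the three-term recurrence of the spherical Bessel functions, whose first
two members have the derivatives prescribed by it, has them at every order. -/
theorem hasDerivAt_of_sphBessel_rec {z : ℕ → ℝ → ℝ}
    (hrec : ∀ n t, z (n + 2) t = (2 * (n + 1) + 1 : ℝ) / t * z (n + 1) t - z n t)
    (h0 : ∀ t, 0 < t → HasDerivAt (z 0) (-z 1 t) t)
    (h1 : ∀ t, 0 < t → HasDerivAt (z 1) (1 / t * z 1 t - z 2 t) t)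
    (n : ℕ) (t : ℝ) (ht : 0 < t) :
    HasDerivAt (z n) (n / t * z n t - z (n + 1) t) t := by
  suffices H : HasDerivAt (z n) (n / t * z n t - z (n + 1) t) t ∧
      HasDerivAt (z (n + 1)) ((n + 1 : ℕ) / t * z (n + 1) t - z (n + 2) t) t from H.1
  induction n with
  | zero => exact ⟨by simpa using h0 t ht, by simpa using h1 t ht⟩
  | succ n ih =>
    refine ⟨ih.2, ?_⟩
    have hd : HasDerivAt (fun s : ℝ => (2 * (n + 1) + 1 : ℝ) / s)
        (-(2 * (n + 1) + 1 : ℝ) / t ^ 2) t := by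
      refine ((hasDerivAt_const t (2 * (n + 1) + 1 : ℝ)).div (hasDerivAt_id t)
        ht.ne').congr_deriv ?_
      simp
    have key := (hd.mul ih.2).sub ih.1
    have e : z n t = (2 * (n + 1) + 1 : ℝ) / t * z (n + 1) t - z (n + 2) t := by
      rw [hrec n t]; ring
    refine (key.congr_of_eventuallyEq (f₁ := z (n + 2))
      (Filter.Eventually.of_forall (hrec n))).congr_deriv ?_
    change _ = ((n + 1 + 1 : ℕ) : ℝ) / t * z (n + 2) t - z ((n + 1) + 2) t
    rw [hrec (n + 1) t, e]
    change _ = ((n + 1 + 1 : ℕ) : ℝ) / t * z (n + 2) t -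
      ((2 * ((n + 1 : ℕ) + 1) + 1 : ℝ) / t * z (n + 2) t - z (n + 1) t)
    push_cast
    field_simp
    ring

theorem hasDerivAt_sphJ (n : ℕ) (t : ℝ) (ht : 0 < t) :
    HasDerivAt (sphJ n) (n / t * sphJ n t - sphJ (n + 1) t) t := by
  refine hasDerivAt_of_sphBessel_rec sphJ_rec (fun t ht => ?_) (fun t ht => ?_) n t ht
  · have : HasDerivAt (fun t : ℝ => Real.sin t / t) _ t :=
      (Real.hasDerivAt_sin t).div (hasDerivAt_id t) ht.ne'
    convert this using 1
    · ext s; simp [sphJ]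
    · simp only [sphJ]; field_simp; ring
  · have : HasDerivAt (fun t : ℝ => Real.sin t / t ^ 2 - Real.cos t / t) _ t :=
      ((Real.hasDerivAt_sin t).div (hasDerivAt_pow 2 t) (pow_ne_zero 2 ht.ne')).sub
        ((Real.hasDerivAt_cos t).div (hasDerivAt_id t) ht.ne')
    convert this using 1
    · ext s; simp [sphJ]
    · rw [sphJ_rec 0]; simp only [sphJ]; push_cast; field_simp; ring

theorem hasDerivAt_sphY (n : ℕ) (t : ℝ) (ht : 0 < t) :
    HasDerivAt (sphY n) (n / t * sphY n t - sphY (n + 1) t) t := by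
  refine hasDerivAt_of_sphBessel_rec sphY_rec (fun t ht => ?_) (fun t ht => ?_) n t ht
  · have : HasDerivAt (fun t : ℝ => -(Real.cos t / t)) _ t :=
      ((Real.hasDerivAt_cos t).div (hasDerivAt_id t) ht.ne').neg
    convert this using 1
    · ext s; simp [sphY]
    · simp only [sphY, id]; field_simp; ring
  · have : HasDerivAt (fun t : ℝ => -(Real.cos t / t ^ 2) - Real.sin t / t) _ t :=
      ((Real.hasDerivAt_cos t).div (hasDerivAt_pow 2 t) (pow_ne_zero 2 ht.ne')).neg.sub
        ((Real.hasDerivAt_sin t).div (hasDerivAt_id t) ht.ne')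
    convert this using 1
    · ext s; simp [sphY]
    · rw [sphY_rec 0]; simp only [sphY]; push_cast; field_simp; ring

theorem sphJ_sphY_wronskian (n : ℕ) (t : ℝ) (ht : 0 < t) :
    sphJ n t * sphY (n + 1) t - sphJ (n + 1) t * sphY n t = -(1 / t ^ 2) := by
  induction n with
  | zero =>
    simp only [sphJ, sphY]
    have := Real.sin_sq_add_cos_sq t
    field_simp
    linear_combination -t * this
  | succ n ih =>
    rw [← ih, sphJ_rec, sphY_rec]; ring

/-- `f` solves `f'' + (2 n + 2) f' / r + k² f = g` on `(0, ∞)`; the two derivatives are carried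
along explicitly. -/
structure RadialODE (n : ℕ) (k : ℝ) (g f f' f'' : ℝ → ℝ) : Prop where
  deriv₁ : ∀ r, 0 < r → HasDerivAt f (f' r) r
  deriv₂ : ∀ r, 0 < r → HasDerivAt f' (f'' r) r
  cont : ContinuousOn f'' (Set.Ioi 0)
  ode : ∀ r, 0 < r → f'' r + (2 * n + 2) / r * f' r + k ^ 2 * f r = g r

/-- The radial factor `z n (k r) / r ^ n` attached to a spherical Bessel sequence. -/
noncomputable def radialFactor (z : ℕ → ℝ → ℝ) (n : ℕ) (k r : ℝ) : ℝ := z n (k * r) / r ^ n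

/-- The derivative of `radialFactor`. -/
noncomputable def radialFactorDeriv (z : ℕ → ℝ → ℝ) (n : ℕ) (k r : ℝ) : ℝ :=
  -(k * z (n + 1) (k * r) / r ^ n)

theorem hasDerivAt_radialFactor {z : ℕ → ℝ → ℝ} {k : ℝ} (hk : 0 < k)
    (hz : ∀ n t, 0 < t → HasDerivAt (z n) (n / t * z n t - z (n + 1) t) t)
    (n : ℕ) (r : ℝ) (hr : 0 < r) :
    HasDerivAt (radialFactor z n k) (radialFactorDeriv z n k r) r := by
  have h1 : HasDerivAt (fun r => z n (k * r)) _ r :=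
    (hz n (k * r) (by positivity)).comp r (by simpa using (hasDerivAt_id r).const_mul k)
  have h2 := h1.div (hasDerivAt_pow n r) (pow_ne_zero n hr.ne')
  refine h2.congr_deriv ?_
  rw [radialFactorDeriv]
  cases n with
  | zero => simp [mul_comm]
  | succ n =>
    simp only [Nat.add_sub_cancel]
    field_simp
    push_cast
    ring

theorem radialODE_radialFactor {z : ℕ → ℝ → ℝ} {k : ℝ} (hk : 0 < k)
    (hrec : ∀ n t, z (n + 2) t = (2 * (n + 1) + 1 : ℝ) / t * z (n + 1) t - z n t)
    (hz : ∀ n t, 0 < t → HasDerivAt (z n) (n / t * z n t - z (n + 1) t) t) (n : ℕ) :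
    RadialODE n k (fun _ => 0) (radialFactor z n k) (radialFactorDeriv z n k)
      (fun r => -((2 * n + 2) / r * radialFactorDeriv z n k r) - k ^ 2 * radialFactor z n k r) := by
  have hd1 := hasDerivAt_radialFactor hk hz n
  have hd2 : ∀ r, 0 < r → HasDerivAt (radialFactorDeriv z n k)
      (-((2 * n + 2) / r * radialFactorDeriv z n k r) - k ^ 2 * radialFactor z n k r) r := by
    intro r hr
    have h := ((hasDerivAt_radialFactor hk hz (n + 1) r hr).mul (hasDerivAt_id r)).const_mul (-k)
    have h' := h.congr_of_eventuallyEq (f₁ := radialFactorDeriv z n k) <| by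
      filter_upwards [lt_mem_nhds hr] with s hs
      simp only [radialFactorDeriv, radialFactor, id, Pi.mul_apply]
      field_simp
      ring
    refine h'.congr_deriv ?_
    simp only [radialFactorDeriv, radialFactor, id, hrec n]
    field_simp
    ring
  refine ⟨hd1, hd2, ?_, fun r hr => by ring⟩
  have c1 : ContinuousOn (radialFactor z n k) (Set.Ioi 0) :=
    fun r hr => (hd1 r hr).continuousAt.continuousWithinAt
  have c2 : ContinuousOn (radialFactorDeriv z n k) (Set.Ioi 0) :=
    fun r hr => (hd2 r hr).continuousAt.continuousWithinAt
  have c3 : ContinuousOn (fun r : ℝ => (2 * n + 2 : ℝ) / r) (Set.Ioi 0) :=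
    continuousOn_const.div continuousOn_id fun r hr => (Set.mem_Ioi.1 hr).ne'
  exact (c3.mul c2).neg.sub (continuousOn_const.mul c1)

/-- Variation of parameters: two homogeneous solutions with nonvanishing Wronskian on which a pair
of boundary functionals is nondegenerate give a solution of the inhomogeneous equation satisfying
both homogeneous boundary conditions. -/
theorem exists_radialODE_boundary {n : ℕ} {k R1 R2 : ℝ} (hR1 : 0 < R1)
    {u u' u'' v v' v'' : ℝ → ℝ}
    (hu : RadialODE n k (fun _ => 0) u u' u'') (hv : RadialODE n k (fun _ => 0) v v' v'')
    (hw : ∀ r, 0 < r → u r * v' r - u' r * v r ≠ 0) (p q : ℝ → ℝ)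
    (hdet : (p R1 * u R1 + q R1 * u' R1) * (p R2 * v R2 + q R2 * v' R2) -
      (p R1 * v R1 + q R1 * v' R1) * (p R2 * u R2 + q R2 * u' R2) ≠ 0)
    (g : ℝ → ℝ) (hg : ContinuousOn g (Set.Ioi 0)) :
    ∃ f f' f'', RadialODE n k g f f' f'' ∧ p R1 * f R1 + q R1 * f' R1 = 0 ∧
      p R2 * f R2 + q R2 * f' R2 = 0 := by
  have cu : ContinuousOn u (Set.Ioi 0) := fun r hr => (hu.1 r hr).continuousAt.continuousWithinAt
  have cu' : ContinuousOn u' (Set.Ioi 0) :=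
    fun r hr => (hu.2 r hr).continuousAt.continuousWithinAt
  have cv : ContinuousOn v (Set.Ioi 0) := fun r hr => (hv.1 r hr).continuousAt.continuousWithinAt
  have cv' : ContinuousOn v' (Set.Ioi 0) :=
    fun r hr => (hv.2 r hr).continuousAt.continuousWithinAt
  have prim : ∀ h : ℝ → ℝ, ContinuousOn h (Set.Ioi 0) →
      ∃ A : ℝ → ℝ, ∀ r, 0 < r → HasDerivAt A (h r) r := by
    intro h hh
    refine ⟨fun r => ∫ s in R1..r, h s, fun r hr => ?_⟩
    have hsub : Set.uIcc R1 r ⊆ Set.Ioi 0 := fun s hs =>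
      lt_of_lt_of_le (lt_min hR1 hr) hs.1
    exact intervalIntegral.integral_hasDerivAt_right (hh.mono hsub).intervalIntegrable
      (hh.stronglyMeasurableAtFilter isOpen_Ioi r hr)
      (hh.continuousAt (isOpen_Ioi.mem_nhds hr))
  set w : ℝ → ℝ := fun r => u r * v' r - u' r * v r with hwdef
  have cw : ContinuousOn w (Set.Ioi 0) := (cu.mul cv').sub (cu'.mul cv)
  obtain ⟨A, hA⟩ := prim (fun r => -(v r * g r) / w r) ((cv.mul hg).neg.div cw hw)
  obtain ⟨B, hB⟩ := prim (fun r => u r * g r / w r) ((cu.mul hg).div cw hw)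
  set D := (p R1 * u R1 + q R1 * u' R1) * (p R2 * v R2 + q R2 * v' R2) -
      (p R1 * v R1 + q R1 * v' R1) * (p R2 * u R2 + q R2 * u' R2) with hD
  obtain ⟨a, b, h1, h2⟩ : ∃ a b : ℝ,
      (A R1 + a) * (p R1 * u R1 + q R1 * u' R1) + (B R1 + b) * (p R1 * v R1 + q R1 * v' R1) = 0 ∧
      (A R2 + a) * (p R2 * u R2 + q R2 * u' R2) +
        (B R2 + b) * (p R2 * v R2 + q R2 * v' R2) = 0 := by
    set x1 := p R1 * u R1 + q R1 * u' R1
    set x2 := p R2 * u R2 + q R2 * u' R2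
    set y1 := p R1 * v R1 + q R1 * v' R1
    set y2 := p R2 * v R2 + q R2 * v' R2
    set c1 := A R1 * x1 + B R1 * y1
    set c2 := A R2 * x2 + B R2 * y2
    refine ⟨(c2 * y1 - c1 * y2) / D, (c1 * x2 - c2 * x1) / D, ?_, ?_⟩
    · simp only [c1, c2]
      field_simp
      rw [hD]; ring
    · simp only [c1, c2]
      field_simp
      rw [hD]; ring
  have hf1 : ∀ r, 0 < r → HasDerivAt (fun r => (A r + a) * u r + (B r + b) * v r)
      ((A r + a) * u' r + (B r + b) * v' r) r := by
    intro r hr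
    refine ((((hA r hr).add_const a).mul (hu.1 r hr)).add
      (((hB r hr).add_const b).mul (hv.1 r hr))).congr_deriv ?_
    have := hw r hr
    simp only [hwdef]
    field_simp
    ring
  have hf2 : ∀ r, 0 < r → HasDerivAt (fun r => (A r + a) * u' r + (B r + b) * v' r)
      ((A r + a) * u'' r + (B r + b) * v'' r + g r) r := by
    intro r hr
    refine ((((hA r hr).add_const a).mul (hu.2 r hr)).add
      (((hB r hr).add_const b).mul (hv.2 r hr))).congr_deriv ?_
    have := hw r hr
    simp only [hwdef]
    rw [div_eq_mul_inv, div_eq_mul_inv]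
    linear_combination g r * mul_inv_cancel₀ this
  have cA : ContinuousOn A (Set.Ioi 0) := fun r hr => (hA r hr).continuousAt.continuousWithinAt
  have cB : ContinuousOn B (Set.Ioi 0) := fun r hr => (hB r hr).continuousAt.continuousWithinAt
  refine ⟨_, _, _, ⟨hf1, hf2, ?_, fun r hr => ?_⟩, by linear_combination h1,
    by linear_combination h2⟩
  · exact (((cA.add continuousOn_const).mul hu.3).add
      ((cB.add continuousOn_const).mul hv.3)).add hg
  · have e1 := hu.4 r hr
    have e2 := hv.4 r hr
    linear_combination (A r + a) * e1 + (B r + b) * e2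

open MvPolynomial in
/-- The polynomial vector field `x ↦ x × W x`. -/
noncomputable def crossX (W : Fin 3 → MvPolynomial (Fin 3) ℂ) : Fin 3 → MvPolynomial (Fin 3) ℂ :=
  ![X 1 * W 2 - X 2 * W 1, X 2 * W 0 - X 0 * W 2, X 0 * W 1 - X 1 * W 0]

open MvPolynomial in
/-- The formal curl of a polynomial vector field. -/
noncomputable def curlP (W : Fin 3 → MvPolynomial (Fin 3) ℂ) : Fin 3 → MvPolynomial (Fin 3) ℂ :=
  ![pderiv 1 (W 2) - pderiv 2 (W 1), pderiv 2 (W 0) - pderiv 0 (W 2),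
    pderiv 0 (W 1) - pderiv 1 (W 0)]

open MvPolynomial in
/-- The formal gradient of a polynomial. -/
noncomputable def gradP (P : MvPolynomial (Fin 3) ℂ) : Fin 3 → MvPolynomial (Fin 3) ℂ :=
  fun i => pderiv i P

open MvPolynomial in
/-- The radial polynomial vector field `x ↦ P x • x`. -/
noncomputable def radP (P : MvPolynomial (Fin 3) ℂ) : Fin 3 → MvPolynomial (Fin 3) ℂ :=
  fun i => X i * P

open MvPolynomial in
/-- The formal Laplacian of a polynomial. -/
noncomputable def lapP (P : MvPolynomial (Fin 3) ℂ) : MvPolynomial (Fin 3) ℂ :=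
  pderiv 0 (pderiv 0 P) + pderiv 1 (pderiv 1 P) + pderiv 2 (pderiv 2 P)

open MvPolynomial in
/-- The polynomial `x ↦ x · W x`. -/
noncomputable def dotX (W : Fin 3 → MvPolynomial (Fin 3) ℂ) : MvPolynomial (Fin 3) ℂ :=
  X 0 * W 0 + X 1 * W 1 + X 2 * W 2

open MvPolynomial in
/-- The squared norm as a polynomial. -/
noncomputable def normSqP : MvPolynomial (Fin 3) ℂ := X 0 ^ 2 + X 1 ^ 2 + X 2 ^ 2

theorem MvPolynomial.pderiv_comm {σ R : Type*} [CommRing R] (i j : σ) (p : MvPolynomial σ R) :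
    pderiv i (pderiv j p) = pderiv j (pderiv i p) := by
  have h : ⁅pderiv (R := R) i, pderiv j⁆ =
      (0 : Derivation R (MvPolynomial σ R) (MvPolynomial σ R)) := by
    classical
    refine derivation_ext fun l => ?_
    rw [Derivation.commutator_apply]
    simp only [pderiv_X, Pi.single_apply, Derivation.coe_zero, Pi.zero_apply]
    split_ifs <;> simp
  have := congrArg (fun D => D p) h
  simpa [Derivation.commutator_apply, sub_eq_zero] using this

section algebra
open MvPolynomial

theorem crossX_radP (P : MvPolynomial (Fin 3) ℂ) : crossX (radP P) = 0 := by
  funext i; fin_cases i <;> simp [crossX, radP] <;> ring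

theorem curlP_gradP (P : MvPolynomial (Fin 3) ℂ) : curlP (gradP P) = 0 := by
  funext i; fin_cases i <;> simp [curlP, gradP, pderiv_comm (1 : Fin 3) 0,
    pderiv_comm (2 : Fin 3) 0, pderiv_comm (2 : Fin 3) 1]

theorem curlP_radP (P : MvPolynomial (Fin 3) ℂ) : curlP (radP P) = -crossX (gradP P) := by
  funext i; fin_cases i <;> simp [curlP, gradP, radP, crossX, pderiv_X]

theorem euler3 {P : MvPolynomial (Fin 3) ℂ} {n : ℕ} (h : P.IsHomogeneous n) :
    X 0 * pderiv 0 P + X 1 * pderiv 1 P + X 2 * pderiv 2 P = C (n : ℂ) * P := by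
  have := h.sum_X_mul_pderiv
  rw [Fin.sum_univ_three] at this
  simpa using this

theorem euler3_pderiv {P : MvPolynomial (Fin 3) ℂ} {n : ℕ} (h : P.IsHomogeneous n) (i : Fin 3) :
    X 0 * pderiv 0 (pderiv i P) + X 1 * pderiv 1 (pderiv i P) + X 2 * pderiv 2 (pderiv i P) =
      C (n - 1 : ℂ) * pderiv i P := by
  have := congrArg (pderiv i) (euler3 h)
  simp only [map_add, pderiv_mul, pderiv_C, pderiv_X] at this
  fin_cases i <;>
    simp [pderiv_comm (1 : Fin 3) 0, pderiv_comm (2 : Fin 3) 0, pderiv_comm (2 : Fin 3) 1]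
      at this ⊢ <;>
    linear_combination this

theorem curlP_crossX_gradP {P : MvPolynomial (Fin 3) ℂ} {n : ℕ} (h : P.IsHomogeneous n) :
    curlP (crossX (gradP P)) = radP (lapP P) - (n + 1 : ℂ) • gradP P := by
  funext i
  have e := euler3_pderiv h i
  fin_cases i <;>
    simp [curlP, gradP, radP, crossX, lapP, pderiv_X, smul_eq_C_mul, pderiv_comm (1 : Fin 3) 0,
      pderiv_comm (2 : Fin 3) 0, pderiv_comm (2 : Fin 3) 1] at e ⊢ <;>
    linear_combination -e

theorem crossX_crossX (W : Fin 3 → MvPolynomial (Fin 3) ℂ) :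
    crossX (crossX W) = radP (dotX W) - (fun i => normSqP * W i) := by
  funext i
  fin_cases i <;> simp [crossX, radP, dotX, normSqP] <;> ring

theorem dotX_gradP {P : MvPolynomial (Fin 3) ℂ} {n : ℕ} (h : P.IsHomogeneous n) :
    dotX (gradP P) = C (n : ℂ) * P := euler3 h

theorem gradP_dotX {W : Fin 3 → MvPolynomial (Fin 3) ℂ} {n : ℕ} (h : ∀ i, (W i).IsHomogeneous n) :
    gradP (dotX W) = (n + 1 : ℂ) • W + crossX (curlP W) := by
  funext i
  have e := euler3 (h i)
  fin_cases i <;>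
    simp [curlP, gradP, crossX, dotX, pderiv_X, smul_eq_C_mul] at e ⊢ <;>
    linear_combination e

end algebra

section calculus

/-- The real-linear functional on `ℝ³` with complex coefficients `a`. -/
noncomputable def gradL (a : Fin 3 → ℂ) : EuclideanSpace ℝ (Fin 3) →L[ℝ] ℂ :=
  ∑ i, (EuclideanSpace.proj i : EuclideanSpace ℝ (Fin 3) →L[ℝ] ℝ).smulRight (a i)

theorem gradL_apply (a : Fin 3 → ℂ) (x : EuclideanSpace ℝ (Fin 3)) :
    gradL a x = ∑ i, (x i : ℂ) * a i := by
  simp [gradL]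

theorem gradL_single (a : Fin 3 → ℂ) (i : Fin 3) : gradL a (EuclideanSpace.single i 1) = a i := by
  rw [gradL_apply, Finset.sum_eq_single i] <;> simp +contextual

theorem pd_eq_of_hasFDerivAt {f : EuclideanSpace ℝ (Fin 3) → ℂ} {a : Fin 3 → ℂ}
    {x : EuclideanSpace ℝ (Fin 3)} (h : HasFDerivAt f (gradL a) x) (i : Fin 3) :
    pd i f x = a i := by
  rw [pd, h.fderiv, gradL_single]

theorem hasFDerivAt_gradL_pd {f : EuclideanSpace ℝ (Fin 3) → ℂ}
    {x : EuclideanSpace ℝ (Fin 3)} (h : DifferentiableAt ℝ f x) :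
    HasFDerivAt f (gradL fun i => pd i f x) x := by
  refine h.hasFDerivAt.congr_fderiv ?_
  ext y
  have hy : y = ∑ i, y i • EuclideanSpace.single i (1 : ℝ) := by
    ext j; simp [Fin.sum_univ_three]; fin_cases j <;> simp
  rw [gradL_apply]
  conv_lhs => rw [hy, map_sum]
  simp [pd]

theorem HasFDerivAt.gradL_mul {f g : EuclideanSpace ℝ (Fin 3) → ℂ} {a b : Fin 3 → ℂ}
    {x : EuclideanSpace ℝ (Fin 3)} (hf : HasFDerivAt f (gradL a) x)
    (hg : HasFDerivAt g (gradL b) x) :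
    HasFDerivAt (fun y => f y * g y) (gradL fun i => f x * b i + a i * g x) x := by
  refine (hf.mul hg).congr_fderiv ?_
  ext y
  simp only [gradL_apply, _root_.add_apply, _root_.smul_apply,
    smul_eq_mul, Fin.sum_univ_three]
  ring

theorem hasFDerivAt_radial {f : ℝ → ℝ} {d : ℝ} {x : EuclideanSpace ℝ (Fin 3)} (hx : x ≠ 0)
    (hf : HasDerivAt f d ‖x‖) :
    HasFDerivAt (fun y : EuclideanSpace ℝ (Fin 3) => ((f ‖y‖ : ℝ) : ℂ))
      (gradL fun i => ((d / ‖x‖ : ℝ) : ℂ) * (x i : ℂ)) x := by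
  have hn : HasFDerivAt (fun y : EuclideanSpace ℝ (Fin 3) => ‖y‖)
      ((1 / ‖x‖) • innerSL ℝ x) x := by
    have h := (hasStrictFDerivAt_norm_sq x).hasFDerivAt.sqrt (by simpa using hx)
    refine (h.congr_of_eventuallyEq (Filter.Eventually.of_forall fun y => ?_)).congr_fderiv ?_
    · exact (Real.sqrt_sq (norm_nonneg y)).symm
    · ext y
      simp [Real.sqrt_sq (norm_nonneg x)]
      ring
  have h := Complex.ofRealCLM.hasFDerivAt.comp x (hf.comp_hasFDerivAt x hn)
  refine h.congr_fderiv ?_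
  ext y
  simp [gradL_apply, PiLp.inner_apply, Fin.sum_univ_three]
  ring

/-- Evaluation of a complex polynomial at a point of `ℝ³`. -/
noncomputable def ev (P : MvPolynomial (Fin 3) ℂ) (x : EuclideanSpace ℝ (Fin 3)) : ℂ :=
  MvPolynomial.eval (fun i => (x i : ℂ)) P

theorem hasFDerivAt_ev (P : MvPolynomial (Fin 3) ℂ) (x : EuclideanSpace ℝ (Fin 3)) :
    HasFDerivAt (ev P) (gradL fun i => ev (MvPolynomial.pderiv i P) x) x := by
  induction P using MvPolynomial.induction_on with
  | C a =>
    have : ev (MvPolynomial.C a) = fun _ => a := by funext y; simp [ev]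
    rw [this]
    refine (hasFDerivAt_const a x).congr_fderiv ?_
    ext y; simp [gradL_apply, ev]
  | add p q hp hq =>
    have : ev (p + q) = fun y => ev p y + ev q y := by funext y; simp [ev]
    rw [this]
    refine (hp.add hq).congr_fderiv ?_
    ext y; simp [gradL_apply, ev, mul_add, Finset.sum_add_distrib]
  | mul_X p i hp =>
    have hX : HasFDerivAt (fun y : EuclideanSpace ℝ (Fin 3) => (y i : ℂ))
        (gradL (Pi.single i 1)) x := by
      refine (Complex.ofRealCLM.comp (EuclideanSpace.proj i :
        EuclideanSpace ℝ (Fin 3) →L[ℝ] ℝ)).hasFDerivAt.congr_fderiv ?_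
      ext y; simp [gradL_apply, Pi.single_apply]
    have : ev (p * MvPolynomial.X i) = fun y => ev p y * (y i : ℂ) := by funext y; simp [ev]
    rw [this]
    refine (hp.gradL_mul hX).congr_fderiv ?_
    congr 1
    funext j
    simp [ev, MvPolynomial.pderiv_X, Pi.single_apply, eq_comm]
    split_ifs <;> simp <;> ring

theorem continuous_ev (P : MvPolynomial (Fin 3) ℂ) : Continuous (ev P) :=
  continuous_iff_continuousAt.2 fun x => (hasFDerivAt_ev P x).continuousAt

/-- The field `x ↦ f ‖x‖ • W x` for a radial factor `f` and a polynomial vector field `W`. -/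
noncomputable def fld (f : ℝ → ℝ) (W : Fin 3 → MvPolynomial (Fin 3) ℂ)
    (x : EuclideanSpace ℝ (Fin 3)) : Fin 3 → ℂ :=
  fun i => ((f ‖x‖ : ℝ) : ℂ) * ev (W i) x

theorem hasFDerivAt_fld {f : ℝ → ℝ} {d : ℝ} {x : EuclideanSpace ℝ (Fin 3)} (hx : x ≠ 0)
    (hf : HasDerivAt f d ‖x‖) (W : Fin 3 → MvPolynomial (Fin 3) ℂ) (j : Fin 3) :
    HasFDerivAt (fun z => fld f W z j) (gradL fun i => ((f ‖x‖ : ℝ) : ℂ) *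
      ev (MvPolynomial.pderiv i (W j)) x + ((d / ‖x‖ : ℝ) : ℂ) * (x i : ℂ) * ev (W j) x) x :=
  (hasFDerivAt_radial hx hf).gradL_mul (hasFDerivAt_ev (W j) x)

theorem curl_fld {f f' : ℝ → ℝ} {x : EuclideanSpace ℝ (Fin 3)} (hx : x ≠ 0)
    (hf : HasDerivAt f (f' ‖x‖) ‖x‖) (W : Fin 3 → MvPolynomial (Fin 3) ℂ) :
    curl (fld f W) x = fld (fun r => f' r / r) (crossX W) x + fld f (curlP W) x := by
  funext i
  simp only [curl, pd_eq_of_hasFDerivAt (hasFDerivAt_fld hx hf W _)]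
  fin_cases i <;> simp [fld, crossX, curlP, ev] <;> ring

theorem continuousOn_fld {f : ℝ → ℝ} (hf : ContinuousOn f (Set.Ioi 0))
    (W : Fin 3 → MvPolynomial (Fin 3) ℂ) : ContinuousOn (fld f W) {0}ᶜ := by
  refine continuousOn_pi.2 fun i => ContinuousOn.mul ?_ (continuous_ev (W i)).continuousOn
  refine Complex.continuous_ofReal.comp_continuousOn (hf.comp continuous_norm.continuousOn ?_)
  intro x hx
  simpa using hx

end calculus

theorem RadialODE.hasDerivAt_div {n : ℕ} {k : ℝ} {g f f' f'' : ℝ → ℝ}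
    (h : RadialODE n k g f f' f'') {r : ℝ} (hr : 0 < r) :
    HasDerivAt (fun s => f' s / s) ((f'' r * r - f' r) / r ^ 2) r := by
  refine ((h.deriv₂ r hr).div (hasDerivAt_id r) hr.ne').congr_deriv ?_
  simp

theorem RadialODE.hasDerivAt_tangential {n : ℕ} {k : ℝ} {g f f' f'' : ℝ → ℝ}
    (h : RadialODE n k g f f' f'') {r : ℝ} (hr : 0 < r) :
    HasDerivAt (fun s => s * f' s + (n + 1) * f s) (r * f'' r + (n + 2) * f' r) r := by
  refine (((hasDerivAt_id r).mul (h.deriv₂ r hr)).add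
    ((h.deriv₁ r hr).const_mul ((n : ℝ) + 1))).congr_deriv ?_
  simp only [id]
  ring

theorem curl_fld_crossX_gradP {f f' : ℝ → ℝ} {x : EuclideanSpace ℝ (Fin 3)} (hx : x ≠ 0)
    (hf : HasDerivAt f (f' ‖x‖) ‖x‖) {P : MvPolynomial (Fin 3) ℂ} {n : ℕ}
    (hP : P.IsHomogeneous n) (i : Fin 3) :
    curl (fld f (crossX (gradP P))) x i = n * fld (fun r => f' r / r) (radP P) x i -
      fld (fun r => r * f' r + (n + 1) * f r) (gradP P) x i + fld f (radP (lapP P)) x i := by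
  have hn : ‖x‖ ≠ 0 := norm_ne_zero_iff.2 hx
  have hsq : ev normSqP x = (‖x‖ : ℂ) ^ 2 := by
    rw [← Complex.ofReal_pow, EuclideanSpace.norm_sq_eq, Fin.sum_univ_three]
    simp [ev, normSqP]
  rw [curl_fld hx hf, crossX_crossX, dotX_gradP hP, curlP_crossX_gradP hP]
  have hn' : (‖x‖ : ℂ) ≠ 0 := by exact_mod_cast hn
  have e : ev (normSqP * gradP P i) x = (‖x‖ : ℂ) ^ 2 * ev (gradP P i) x := by
    rw [← hsq]; simp [ev]
  have e' : ev (radP (MvPolynomial.C (n : ℂ) * P) i) x = n * ev (radP P i) x := by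
    simp [ev, radP]; ring
  have sub : ∀ p q : MvPolynomial (Fin 3) ℂ, ev (p - q) x = ev p x - ev q x := by simp [ev]
  simp only [Pi.add_apply, fld, Pi.sub_apply, sub, e, e', Pi.smul_apply]
  have e'' : ev (((n : ℂ) + 1) • gradP P i) x = (n + 1) * ev (gradP P i) x := by
    simp [ev]
  rw [e'']
  push_cast
  field_simp
  ring

theorem curl_comb {F G : EuclideanSpace ℝ (Fin 3) → Fin 3 → ℂ} {x : EuclideanSpace ℝ (Fin 3)}
    (hF : ∀ i, DifferentiableAt ℝ (fun z => F z i) x)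
    (hG : ∀ i, DifferentiableAt ℝ (fun z => G z i) x) (a b : ℂ) (i : Fin 3) :
    curl (fun z i => a * F z i + b * G z i) x i = a * curl F x i + b * curl G x i := by
  have h : ∀ i j, pd i (fun z => a * F z j + b * G z j) x =
      a * pd i (fun z => F z j) x + b * pd i (fun z => G z j) x := by
    intro i j
    have h1 := ((hF j).hasFDerivAt.const_mul a).add ((hG j).hasFDerivAt.const_mul b)
    have h2 : HasFDerivAt (fun z => a * F z j + b * G z j) _ x := h1
    rw [pd, h2.fderiv]
    simp [pd]
  fin_cases i <;> simp [curl, h] <;> ring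

theorem shell_ne_zero {R1 R2 : ℝ} (hR1 : 0 < R1) {x : EuclideanSpace ℝ (Fin 3)}
    (hx : x ∈ shell R1 R2) : x ≠ 0 := by
  rintro rfl
  simp [shell, hR1.le] at hx

theorem closure_shell_subset (R1 R2 : ℝ) :
    closure (shell R1 R2) ⊆ {x | R1 ≤ ‖x‖ ∧ ‖x‖ ≤ R2} := by
  refine closure_minimal ?_ ((isClosed_le continuous_const continuous_norm).inter
    (isClosed_le continuous_norm continuous_const))
  intro x hx
  simp only [shell, Set.mem_sdiff, Metric.mem_ball, Metric.mem_closedBall, dist_zero_right,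
    not_le] at hx
  exact ⟨hx.2.le, hx.1.le⟩

theorem closure_shell_ne_zero {R1 R2 : ℝ} (hR1 : 0 < R1) :
    closure (shell R1 R2) ⊆ {0}ᶜ := by
  intro x hx
  have := (closure_shell_subset R1 R2 hx).1
  simp only [Set.mem_compl_iff, Set.mem_singleton_iff]
  rintro rfl
  simp at this
  linarith

/-- A pair of fields, each proportional to the curl of the other, one of which has vanishing
tangential trace, yields a Maxwell eigenvalue. -/
theorem isMaxwellEigenvalue_of_curl_curl {k R1 R2 : ℝ} (hk : 0 < k) (hR1 : 0 < R1)
    {F G : EuclideanSpace ℝ (Fin 3) → Fin 3 → ℂ}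
    (hF : ∀ x, x ≠ 0 → ∀ i, DifferentiableAt ℝ (fun z => F z i) x)
    (hG : ∀ x, x ≠ 0 → ∀ i, DifferentiableAt ℝ (fun z => G z i) x)
    (hFG : ∀ x, x ≠ 0 → ∀ i, curl F x i = G x i)
    (hGF : ∀ x, x ≠ 0 → ∀ i, curl G x i = k ^ 2 * F x i)
    (hbd : (∀ x : EuclideanSpace ℝ (Fin 3), ‖x‖ = R1 ∨ ‖x‖ = R2 →
        crossC (fun i => (x i : ℂ)) (F x) = 0) ∨
      (∀ x : EuclideanSpace ℝ (Fin 3), ‖x‖ = R1 ∨ ‖x‖ = R2 →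
        crossC (fun i => (x i : ℂ)) (G x) = 0))
    (hne : ∃ x ∈ shell R1 R2, F x ≠ 0) : IsMaxwellEigenvalue k R1 R2 := by
  have hk' : (k : ℂ) ≠ 0 := by exact_mod_cast hk.ne'
  have cF : ContinuousOn F (closure (shell R1 R2)) := continuousOn_pi.2 fun i x hx =>
    (hF x (closure_shell_ne_zero hR1 hx) i).continuousAt.continuousWithinAt
  have cG : ContinuousOn G (closure (shell R1 R2)) := continuousOn_pi.2 fun i x hx =>
    (hG x (closure_shell_ne_zero hR1 hx) i).continuousAt.continuousWithinAt
  have hcG : ∀ c : ℂ, ContinuousOn (fun z i => c * G z i + 0 * G z i) (closure (shell R1 R2)) :=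
    fun c => continuousOn_pi.2 fun i => ((continuousOn_pi.1 cG i).const_mul c).add
      ((continuousOn_pi.1 cG i).const_mul 0)
  have hdG : ∀ c : ℂ, ∀ x ∈ shell R1 R2, ∀ i : Fin 3,
      DifferentiableAt ℝ (fun z => c * G z i + 0 * G z i) x := fun c x hx i =>
    ((hG x (shell_ne_zero hR1 hx) i).const_mul c).add
      ((hG x (shell_ne_zero hR1 hx) i).const_mul 0)
  obtain ⟨x₀, hx₀, hne⟩ := hne
  rcases hbd with hbd | hbd
  · refine ⟨F, fun z i => (1 / (I * k)) * G z i + 0 * G z i, cF, hcG _,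
      fun x hx => hF x (shell_ne_zero hR1 hx), hdG _, fun x hx => ?_, fun x hx => ?_, hbd,
      fun h => hne (h x₀ hx₀).1⟩
    · funext i
      rw [hFG x (shell_ne_zero hR1 hx)]
      field_simp [I_ne_zero]
      ring
    · funext i
      have hx0 := shell_ne_zero hR1 hx
      rw [curl_comb (hG x hx0) (hG x hx0), hGF x hx0]
      have := I_sq
      field_simp [I_ne_zero]
      linear_combination (F x i) * this
  · refine ⟨fun z i => (-1 / (I * k)) * G z i + 0 * G z i, F, hcG _, cF, hdG _,
      fun x hx => hF x (shell_ne_zero hR1 hx), fun x hx => ?_, fun x hx => ?_, fun x hx => ?_,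
      fun h => hne (h x₀ hx₀).2⟩
    · funext i
      have hx0 := shell_ne_zero hR1 hx
      rw [curl_comb (hG x hx0) (hG x hx0), hGF x hx0]
      have := I_sq
      field_simp [I_ne_zero]
      linear_combination (-F x i) * this
    · funext i
      rw [hFG x (shell_ne_zero hR1 hx)]
      field_simp [I_ne_zero]
      ring
    · have h := hbd x hx
      funext i
      have hi := congrFun h i
      fin_cases i <;> simp [crossC] at hi ⊢ <;> linear_combination (-1 / (I * k)) * hi

section null
open MvPolynomial

/-- The harmonic polynomial `(x₀ + i x₁) ^ n`. -/
noncomputable def nullPow (n : ℕ) : MvPolynomial (Fin 3) ℂ := (X 0 + C I * X 1) ^ n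

theorem isHomogeneous_nullPow (n : ℕ) : (nullPow n).IsHomogeneous n := by
  have h : (X 0 + C I * X 1 : MvPolynomial (Fin 3) ℂ).IsHomogeneous 1 := by
    refine (isHomogeneous_X ℂ 0).add ?_
    simpa using (isHomogeneous_C (Fin 3) I).mul (isHomogeneous_X ℂ (1 : Fin 3))
  simpa [nullPow] using h.pow n

theorem lapP_nullPow (n : ℕ) : lapP (nullPow n) = 0 := by
  have hI : (C I : MvPolynomial (Fin 3) ℂ) * C I = -1 := by
    rw [← C_mul, I_mul_I, C_neg, C_1]
  have h0 : pderiv (0 : Fin 3) (nullPow n) =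
      (n : MvPolynomial (Fin 3) ℂ) * (X 0 + C I * X 1) ^ (n - 1) := by
    simp [nullPow, pderiv_X]
  have h1 : pderiv (1 : Fin 3) (nullPow n) =
      (n : MvPolynomial (Fin 3) ℂ) * (X 0 + C I * X 1) ^ (n - 1) * C I := by
    simp [nullPow, pderiv_X, mul_assoc]
  have h2 : pderiv (2 : Fin 3) (nullPow n) = 0 := by
    simp [nullPow, pderiv_X]
  rw [lapP, h0, h1, h2]
  simp [pderiv_X]
  linear_combination ((n : MvPolynomial (Fin 3) ℂ) * ((n - 1 : ℕ) : MvPolynomial (Fin 3) ℂ) *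
    (X 0 + C I * X 1) ^ (n - 1 - 1)) * hI

end null

theorem fld_eq_zero {f : ℝ → ℝ} {x : EuclideanSpace ℝ (Fin 3)} (hf : f ‖x‖ = 0)
    (W : Fin 3 → MvPolynomial (Fin 3) ℂ) : fld f W x = 0 := by
  funext i; simp [fld, hf]

/-- A nontrivial radial solution satisfying either pair of boundary conditions yields a Maxwell
eigenvalue. -/
theorem isMaxwellEigenvalue_of_radialODE {n : ℕ} (hn : 1 ≤ n) {k R1 R2 : ℝ} (hk : 0 < k)
    (hR1 : 0 < R1) {f f' f'' : ℝ → ℝ} (hf : RadialODE n k (fun _ => 0) f f' f'')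
    (hne : ∃ r, R1 < r ∧ r < R2 ∧ f r ≠ 0)
    (hbd : (f R1 = 0 ∧ f R2 = 0) ∨
      (R1 * f' R1 + (n + 1) * f R1 = 0 ∧ R2 * f' R2 + (n + 1) * f R2 = 0)) :
    IsMaxwellEigenvalue k R1 R2 := by
  have hP := isHomogeneous_nullPow n
  have hL := lapP_nullPow n
  have hpos : ∀ x : EuclideanSpace ℝ (Fin 3), x ≠ 0 → 0 < ‖x‖ := fun x hx => norm_pos_iff.2 hx
  have d1 := fun x (hx : x ≠ 0) i =>
    (hasFDerivAt_fld hx (hf.deriv₁ _ (hpos x hx)) (crossX (gradP (nullPow n))) i).differentiableAt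
  have d2 := fun x (hx : x ≠ 0) i =>
    (hasFDerivAt_fld hx (hf.hasDerivAt_div (hpos x hx)) (radP (nullPow n)) i).differentiableAt
  have d3 := fun x (hx : x ≠ 0) i =>
    (hasFDerivAt_fld hx (hf.hasDerivAt_tangential (hpos x hx))
      (gradP (nullPow n)) i).differentiableAt
  refine isMaxwellEigenvalue_of_curl_curl hk hR1 (F := fld f (crossX (gradP (nullPow n))))
    (G := fun z i => n * fld (fun r => f' r / r) (radP (nullPow n)) z i +
      (-1) * fld (fun r => r * f' r + (n + 1) * f r) (gradP (nullPow n)) z i)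
    d1 (fun x hx i => ((d2 x hx i).const_mul _).add ((d3 x hx i).const_mul _))
    (fun x hx i => ?_) (fun x hx i => ?_) ?_ ?_
  · rw [curl_fld_crossX_gradP hx (hf.deriv₁ _ (hpos x hx)) hP, hL]
    simp [fld, radP, ev]
    ring
  · have hx' := hpos x hx
    have hode := hf.ode _ hx'
    rw [curl_comb (d2 x hx) (d3 x hx),
      curl_fld (f' := fun r => (f'' r * r - f' r) / r ^ 2) hx (hf.hasDerivAt_div hx'),
      curl_fld (f' := fun r => r * f'' r + (n + 2) * f' r) hx (hf.hasDerivAt_tangential hx'),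
      crossX_radP, curlP_radP, curlP_gradP]
    have neg : ∀ p : MvPolynomial (Fin 3) ℂ, ev (-p) x = - ev p x := by simp [ev]
    have zero : ev 0 x = 0 := by simp [ev]
    simp only [Pi.add_apply, fld, Pi.neg_apply, Pi.zero_apply, neg, zero]
    have key : (n : ℝ) * (f' ‖x‖ / ‖x‖) + (‖x‖ * f'' ‖x‖ + (n + 2) * f' ‖x‖) / ‖x‖ =
        - (k ^ 2 * f ‖x‖) := by
      have := hx'.ne'
      rw [eq_neg_iff_add_eq_zero, ← hode]
      field_simp
      ring
    have key' := congrArg (Complex.ofReal) key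
    push_cast at key' ⊢
    linear_combination (-ev (crossX (gradP (nullPow n)) i) x) * key'
  · refine hbd.imp (fun h x hx => ?_) (fun h x hx => ?_)
    · have h0 : f ‖x‖ = 0 := by rcases hx with hx | hx <;> rw [hx]; exacts [h.1, h.2]
      rw [fld_eq_zero h0]
      funext i; fin_cases i <;> simp [crossC]
    · have h0 : ‖x‖ * f' ‖x‖ + (n + 1) * f ‖x‖ = 0 := by
        rcases hx with hx | hx <;> rw [hx]; exacts [h.1, h.2]
      have h1 := fun i => congrFun (fld_eq_zero (f := fun r => r * f' r + (n + 1) * f r) h0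
        (gradP (nullPow n))) i
      simp only [h1]
      funext i; fin_cases i <;> simp [crossC, fld, radP, ev] <;> ring
  · obtain ⟨r, hr1, hr2, hr⟩ := hne
    have hr0 : 0 < r := hR1.trans hr1
    have hnorm : ‖EuclideanSpace.single (0 : Fin 3) r‖ = r := by simp [abs_of_pos hr0]
    refine ⟨EuclideanSpace.single 0 r, ?_, fun h => ?_⟩
    · simp only [shell, Set.mem_sdiff, Metric.mem_ball, Metric.mem_closedBall, dist_zero_right,
        hnorm]
      exact ⟨hr2, not_le.2 hr1⟩
    · have h2 := congrFun h 2
      simp [fld, crossX, gradP, ev, abs_of_pos hr0, hr, nullPow,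
        MvPolynomial.pderiv_X, hr0.ne'] at h2
      omega

section divergence
open MeasureTheory

theorem integral_divergence_eq_zero {F : EuclideanSpace ℝ (Fin 3) → Fin 3 → ℂ}
    {A : EuclideanSpace ℝ (Fin 3) → Fin 3 → Fin 3 → ℂ}
    (hF : ∀ x j, HasFDerivAt (fun z => F z j) (gradL (A x j)) x) {R : ℝ}
    (hFR : ∀ x, R ≤ ‖x‖ → F x = 0) (hAR : ∀ x, R ≤ ‖x‖ → ∑ i, A x i i = 0)
    (hR : 0 ≤ R) (hint : Integrable fun x => ∑ i, A x i i) :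
    ∫ x, ∑ i, A x i i = 0 := by
  have hmp := PiLp.volume_preserving_toLp (Fin 3)
  have hemb : MeasurableEmbedding (@WithLp.toLp 2 (Fin 3 → ℝ)) :=
    (MeasurableEquiv.toLp 2 (Fin 3 → ℝ)).measurableEmbedding
  have hcoord : ∀ (y : Fin 3 → ℝ) i, |y i| ≤ ‖(WithLp.toLp 2 y : EuclideanSpace ℝ (Fin 3))‖ :=
    fun y i => by simpa using PiLp.norm_apply_le (WithLp.toLp 2 y : EuclideanSpace ℝ (Fin 3)) i
  have hint' : Integrable fun y : Fin 3 → ℝ => ∑ i, A (WithLp.toLp 2 y) i i :=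
    (hmp.integrable_comp_emb hemb).2 hint
  let T : (Fin 3 → ℝ) →L[ℝ] EuclideanSpace ℝ (Fin 3) :=
    ((EuclideanSpace.equiv (Fin 3) ℝ).symm : (Fin 3 → ℝ) →L[ℝ] EuclideanSpace ℝ (Fin 3))
  have hd : ∀ y : Fin 3 → ℝ, ∀ i, HasFDerivAt (fun y => F (WithLp.toLp 2 y) i)
      ((gradL (A (WithLp.toLp 2 y) i)).comp T) y := fun y i =>
    (hF (WithLp.toLp 2 y) i).comp y T.hasFDerivAt
  have hdiv : ∀ y : Fin 3 → ℝ, ∑ i, ((gradL (A (WithLp.toLp 2 y) i)).comp T) (Pi.single i 1) =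
      ∑ i, A (WithLp.toLp 2 y) i i := by
    intro y
    refine Finset.sum_congr rfl fun i _ => ?_
    rw [← gradL_single (A (WithLp.toLp 2 y) i) i]
    rfl
  have key := integral_divergence_of_hasFDerivAt_off_countable' (n := 2) (fun _ => -R) (fun _ => R)
    (fun _ => by linarith) (fun i y => F (WithLp.toLp 2 y) i)
    (fun i y => (gradL (A (WithLp.toLp 2 y) i)).comp T) ∅ Set.countable_empty
    (fun i y _ => (hd y i).continuousAt.continuousWithinAt) (fun y _ i => hd y i)
    (by simp only [hdiv]; exact hint'.integrableOn)
  simp only [hdiv] at key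
  have hface : ∀ (i : Fin 3) (c : ℝ) (y : Fin 2 → ℝ), |c| = R →
      F (WithLp.toLp 2 (i.insertNth c y)) i = 0 := by
    intro i c y hc
    rw [hFR]
    · rfl
    · have := hcoord (i.insertNth c y) i
      simp only [Fin.insertNth_apply_same, hc] at this
      exact this
  have h0 : ∀ (i : Fin 3) (y : Fin 2 → ℝ), F (WithLp.toLp 2 (i.insertNth R y)) i = 0 :=
    fun i y => hface i R y (abs_of_nonneg hR)
  have h1 : ∀ (i : Fin 3) (y : Fin 2 → ℝ), F (WithLp.toLp 2 (i.insertNth (-R) y)) i = 0 :=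
    fun i y => hface i (-R) y (by rw [abs_neg, abs_of_nonneg hR])
  simp only [h0, h1, integral_zero, sub_zero, Finset.sum_const_zero] at key
  rw [← hmp.integral_comp hemb, ← key]
  refine (setIntegral_eq_integral_of_forall_compl_eq_zero fun y hy => hAR _ ?_).symm
  by_contra! hlt
  refine hy ⟨fun i => ?_, fun i => ?_⟩
  · exact (abs_le.1 ((hcoord y i).trans hlt.le)).1
  · exact (abs_le.1 ((hcoord y i).trans hlt.le)).2

end divergence

/-- The quadratic-type defining function of the shell: it is positive exactly on the shell. -/
noncomputable def bump (R1 R2 r : ℝ) : ℝ := (r ^ 2 - R1 ^ 2) * (R2 ^ 2 - r ^ 2)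

theorem hasDerivAt_bump (R1 R2 r : ℝ) :
    HasDerivAt (bump R1 R2) (2 * r * (R1 ^ 2 + R2 ^ 2 - 2 * r ^ 2)) r := by
  have h := ((hasDerivAt_pow 2 r).sub_const (R1 ^ 2)).mul ((hasDerivAt_pow 2 r).const_sub (R2 ^ 2))
  refine h.congr_deriv ?_
  simp
  ring

theorem mem_shell {R1 R2 : ℝ} {x : EuclideanSpace ℝ (Fin 3)} :
    x ∈ shell R1 R2 ↔ R1 < ‖x‖ ∧ ‖x‖ < R2 := by
  simp [shell, and_comm]

theorem isOpen_shell (R1 R2 : ℝ) : IsOpen (shell R1 R2) :=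
  Metric.isOpen_ball.sdiff Metric.isClosed_closedBall

theorem bump_pos {R1 R2 : ℝ} (hR1 : 0 < R1) {x : EuclideanSpace ℝ (Fin 3)}
    (hx : x ∈ shell R1 R2) : 0 < bump R1 R2 ‖x‖ := by
  obtain ⟨h1, h2⟩ := mem_shell.1 hx
  exact mul_pos (by nlinarith) (by nlinarith)

theorem bump_nonpos {R1 R2 : ℝ} (hR1 : 0 < R1) (hR : R1 < R2) {x : EuclideanSpace ℝ (Fin 3)}
    (hx : x ∉ shell R1 R2) : bump R1 R2 ‖x‖ ≤ 0 := by
  have hn := norm_nonneg x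
  rw [mem_shell, not_and_or, not_lt, not_lt] at hx
  rcases hx with h | h
  · exact mul_nonpos_of_nonpos_of_nonneg (by nlinarith) (by nlinarith)
  · exact mul_nonpos_of_nonneg_of_nonpos (by nlinarith) (by nlinarith)

theorem isCompact_closure_shell (R1 R2 : ℝ) : IsCompact (closure (shell R1 R2)) :=
  (Metric.isBounded_ball.subset Set.sdiff_subset).isCompact_closure

theorem ContinuousOn.integrableOn_shell {R1 R2 : ℝ} {f : EuclideanSpace ℝ (Fin 3) → ℂ}
    (hf : ContinuousOn f (closure (shell R1 R2))) :
    MeasureTheory.IntegrableOn f (shell R1 R2) :=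
  (hf.integrableOn_compact (isCompact_closure_shell R1 R2)).mono_set subset_closure

section cutoff
open MeasureTheory

/-- The derivative of the smooth transition function. -/
theorem Real.smoothTransition.hasDerivAt (s : ℝ) :
    HasDerivAt Real.smoothTransition (deriv Real.smoothTransition s) s :=
  ((Real.smoothTransition.contDiff (n := 1)).differentiable one_ne_zero s).hasDerivAt

theorem Real.smoothTransition.continuous_deriv : Continuous (deriv Real.smoothTransition) :=
  (Real.smoothTransition.contDiff (n := 1)).continuous_deriv le_rfl

/-- The cutoff of the shell at height `ε` of `bump`. -/
noncomputable def cutoff (R1 R2 ε r : ℝ) : ℝ := Real.smoothTransition (bump R1 R2 r / ε - 1)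

/-- The radial derivative of `cutoff` divided by `2 r (R1² + R2² - 2 r²)`. -/
noncomputable def cutoffSlope (R1 R2 ε r : ℝ) : ℝ :=
  deriv Real.smoothTransition (bump R1 R2 r / ε - 1) / ε

theorem hasDerivAt_cutoff (R1 R2 ε r : ℝ) : HasDerivAt (cutoff R1 R2 ε)
    (cutoffSlope R1 R2 ε r * (2 * r * (R1 ^ 2 + R2 ^ 2 - 2 * r ^ 2))) r := by
  refine ((Real.smoothTransition.hasDerivAt _).comp r
    (((hasDerivAt_bump R1 R2 r).div_const ε).sub_const 1)).congr_deriv ?_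
  rw [cutoffSlope]
  ring

theorem continuous_bump (R1 R2 : ℝ) : Continuous (bump R1 R2) := by
  unfold bump; fun_prop

theorem continuous_cutoff (R1 R2 ε : ℝ) : Continuous (cutoff R1 R2 ε) :=
  Real.smoothTransition.continuous.comp (((continuous_bump R1 R2).div_const ε).sub continuous_const)

theorem continuous_cutoffSlope (R1 R2 ε : ℝ) : Continuous (cutoffSlope R1 R2 ε) :=
  (Real.smoothTransition.continuous_deriv.comp
    (((continuous_bump R1 R2).div_const ε).sub continuous_const)).div_const ε

theorem cutoffSlope_nonneg (R1 R2 r : ℝ) {ε : ℝ} (hε : 0 < ε) : 0 ≤ cutoffSlope R1 R2 ε r :=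
  div_nonneg Real.smoothTransition.monotone.deriv_nonneg hε.le

theorem cutoffSlope_eq_zero (R1 R2 r : ℝ) {ε : ℝ} (hε : 0 < ε) (h : 2 * ε < bump R1 R2 r) :
    cutoffSlope R1 R2 ε r = 0 := by
  have h1 : 1 < bump R1 R2 r / ε - 1 := by
    rw [lt_sub_iff_add_lt, lt_div_iff₀ hε]; linarith
  have : Real.smoothTransition =ᶠ[nhds (bump R1 R2 r / ε - 1)] fun _ => 1 := by
    filter_upwards [lt_mem_nhds h1] with s hs using Real.smoothTransition.one_of_one_le hs.le
  rw [cutoffSlope, this.deriv_eq]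
  simp

theorem cutoff_eventuallyEq_zero {R1 R2 ε : ℝ} (hε : 0 < ε) {x : EuclideanSpace ℝ (Fin 3)}
    (h : bump R1 R2 ‖x‖ ≤ 0) : ∀ᶠ y in nhds x, cutoff R1 R2 ε ‖y‖ = 0 := by
  have h1 : bump R1 R2 ‖x‖ / ε - 1 < 0 := by
    have := div_nonpos_of_nonpos_of_nonneg h hε.le
    linarith
  have hc : Continuous fun y : EuclideanSpace ℝ (Fin 3) => bump R1 R2 ‖y‖ / ε - 1 :=
    (((continuous_bump R1 R2).comp continuous_norm).div_const ε).sub continuous_const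
  filter_upwards [hc.continuousAt.eventually_lt continuousAt_const h1] with y hy
  exact Real.smoothTransition.zero_of_nonpos hy.le

/-- The divergence of a vector field on `ℝ³`. -/
noncomputable def dvg (V : EuclideanSpace ℝ (Fin 3) → Fin 3 → ℂ) (x : EuclideanSpace ℝ (Fin 3)) :
    ℂ := ∑ i, pd i (fun z => V z i) x

theorem setIntegral_cutoff_divergence {R1 R2 ε : ℝ} (hR1 : 0 < R1) (hR : R1 < R2) (hε : 0 < ε)
    {V : EuclideanSpace ℝ (Fin 3) → Fin 3 → ℂ} {D : EuclideanSpace ℝ (Fin 3) → ℂ}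
    (hV : ContinuousOn V (closure (shell R1 R2))) (hD : ContinuousOn D (closure (shell R1 R2)))
    (hd : ∀ x ∈ shell R1 R2, ∀ i, DifferentiableAt ℝ (fun z => V z i) x)
    (hdiv : ∀ x ∈ shell R1 R2, dvg V x = D x) :
    ∫ x in shell R1 R2, (cutoff R1 R2 ε ‖x‖ : ℂ) * D x = - ∫ x in shell R1 R2,
      (cutoffSlope R1 R2 ε ‖x‖ * (2 * (R1 ^ 2 + R2 ^ 2 - 2 * ‖x‖ ^ 2)) : ℝ) *
        ∑ i, (x i : ℂ) * V x i := by
  classical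
  set S := shell R1 R2 with hS
  have hSm : MeasurableSet S := (isOpen_shell R1 R2).measurableSet
  set c : EuclideanSpace ℝ (Fin 3) → ℝ := fun x =>
    cutoffSlope R1 R2 ε ‖x‖ * (2 * (R1 ^ 2 + R2 ^ 2 - 2 * ‖x‖ ^ 2)) with hc
  let A : EuclideanSpace ℝ (Fin 3) → Fin 3 → Fin 3 → ℂ := fun x j i =>
    if x ∈ S then (cutoff R1 R2 ε ‖x‖ : ℂ) * pd i (fun z => V z j) x + (c x : ℂ) * (x i) * V x j
    else 0
  have hcont1 : ContinuousOn (fun x => (cutoff R1 R2 ε ‖x‖ : ℂ) * D x) (closure S) :=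
    (Complex.continuous_ofReal.comp
      ((continuous_cutoff R1 R2 ε).comp continuous_norm)).continuousOn.mul hD
  have hccont : Continuous c :=
    ((continuous_cutoffSlope R1 R2 ε).comp continuous_norm).mul (by fun_prop)
  have hcont2 : ContinuousOn (fun x => (c x : ℂ) * ∑ i, (x i : ℂ) * V x i) (closure S) := by
    refine (Complex.continuous_ofReal.comp hccont).continuousOn.mul
      (continuousOn_finsetSum _ fun i _ => ContinuousOn.mul ?_ (continuousOn_pi.1 hV i))
    exact (Complex.continuous_ofReal.comp (by fun_prop)).continuousOn
  have hAeq : (fun x => ∑ i, A x i i) =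
      S.indicator fun x => (cutoff R1 R2 ε ‖x‖ : ℂ) * D x + (c x : ℂ) * ∑ i, (x i : ℂ) * V x i := by
    funext x
    by_cases hx : x ∈ S
    · rw [Set.indicator_of_mem hx, ← hdiv x hx]
      simp only [A, if_pos hx, dvg, Finset.sum_add_distrib, Finset.mul_sum]
      simp only [mul_assoc]
    · rw [Set.indicator_of_notMem hx]
      simp [A, hx]
  have key := integral_divergence_eq_zero (F := fun x i => (cutoff R1 R2 ε ‖x‖ : ℂ) * V x i)
    (A := A) (R := R2) (fun x j => ?_) (fun x hx => ?_) (fun x hx => ?_) (hR1.trans hR).le ?_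
  · rw [hAeq, integral_indicator hSm, integral_add hcont1.integrableOn_shell
      hcont2.integrableOn_shell] at key
    exact eq_neg_of_add_eq_zero_left key
  · by_cases hx : x ∈ S
    · have hx0 := shell_ne_zero hR1 hx
      have h1 := (hasFDerivAt_radial hx0 (hasDerivAt_cutoff R1 R2 ε ‖x‖)).gradL_mul
        (hasFDerivAt_gradL_pd (hd x hx j))
      refine h1.congr_fderiv (congrArg gradL (funext fun i => ?_))
      simp only [A, if_pos hx, hc]
      have : (‖x‖ : ℂ) ≠ 0 := by exact_mod_cast norm_ne_zero_iff.2 hx0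
      push_cast
      field_simp
    · have h0 := cutoff_eventuallyEq_zero hε (bump_nonpos hR1 hR hx)
      have : gradL (A x j) = 0 := by ext y; simp [gradL_apply, A, hx]
      rw [this]
      refine (hasFDerivAt_const (0 : ℂ) x).congr_of_eventuallyEq ?_
      filter_upwards [h0] with y hy
      simp [hy]
  · have hx' : x ∉ S := fun h => (mem_shell.1 h).2.not_ge hx
    have := (cutoff_eventuallyEq_zero hε (bump_nonpos hR1 hR hx')).self_of_nhds
    funext i
    simp [this]
  · have hx' : x ∉ S := fun h => (mem_shell.1 h).2.not_ge hx
    simp [A, hx']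
  · rw [hAeq, integrable_indicator_iff hSm]
    exact hcont1.integrableOn_shell.add hcont2.integrableOn_shell

end cutoff

section divergenceShell
open MeasureTheory

theorem exists_bump_lt_imp_lt {R1 R2 : ℝ} (hR1 : 0 < R1)
    {w : EuclideanSpace ℝ (Fin 3) → ℂ} (hw : ContinuousOn w (closure (shell R1 R2)))
    (hbd : ∀ x, ‖x‖ = R1 ∨ ‖x‖ = R2 → w x = 0) {η : ℝ} (hη : 0 < η) :
    ∃ δ, 0 < δ ∧ ∀ x ∈ shell R1 R2, bump R1 R2 ‖x‖ < δ → ‖w x‖ < η := by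
  have hK : IsCompact (closure (shell R1 R2) ∩ (fun x => ‖w x‖) ⁻¹' Set.Ici η) :=
    (isCompact_closure_shell R1 R2).of_isClosed_subset
      (hw.norm.preimage_isClosed_of_isClosed isClosed_closure isClosed_Ici) Set.inter_subset_left
  rcases Set.eq_empty_or_nonempty
    (closure (shell R1 R2) ∩ (fun x => ‖w x‖) ⁻¹' Set.Ici η) with h | h
  · refine ⟨1, one_pos, fun x hx _ => ?_⟩
    by_contra! hlt
    exact (h ▸ (⟨subset_closure hx, hlt⟩ : x ∈ closure (shell R1 R2) ∩
      (fun x => ‖w x‖) ⁻¹' Set.Ici η) : x ∈ (∅ : Set _))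
  · obtain ⟨x₀, ⟨hx₀, hx₀w⟩, hmin⟩ := hK.exists_isMinOn h
      ((continuous_bump R1 R2).comp continuous_norm).continuousOn
    have hne : w x₀ ≠ 0 := fun h0 => by
      simp only [Set.mem_preimage, h0, norm_zero, Set.mem_Ici] at hx₀w
      linarith
    have hr := closure_shell_subset R1 R2 hx₀
    have h1 : R1 < ‖x₀‖ := lt_of_le_of_ne hr.1 fun h => hne (hbd x₀ (Or.inl h.symm))
    have h2 : ‖x₀‖ < R2 := lt_of_le_of_ne hr.2 fun h => hne (hbd x₀ (Or.inr h))
    refine ⟨bump R1 R2 ‖x₀‖, bump_pos hR1 (mem_shell.2 ⟨h1, h2⟩), fun x hx hlt => ?_⟩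
    by_contra! hle
    exact hlt.not_ge (hmin ⟨subset_closure hx, hle⟩)

/-- The weight `R1² + R2² - 2 r²` bounding the slope of the cutoff. -/
noncomputable def shellWeight (R1 R2 r : ℝ) : ℝ := R1 ^ 2 + R2 ^ 2 - 2 * r ^ 2

theorem continuous_shellWeight (R1 R2 : ℝ) : Continuous (shellWeight R1 R2) := by
  unfold shellWeight; fun_prop

theorem setIntegral_cutoffSlope_le {R1 R2 ε : ℝ} (hR1 : 0 < R1) (hR : R1 < R2) (hε : 0 < ε) :
    ∫ x in shell R1 R2, cutoffSlope R1 R2 ε ‖x‖ * (2 * shellWeight R1 R2 ‖x‖ ^ 2 * ‖x‖ ^ 2) ≤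
      ∫ x in shell R1 R2, |3 * shellWeight R1 R2 ‖x‖ - 4 * ‖x‖ ^ 2| := by
  have hW : ∀ r, HasDerivAt (shellWeight R1 R2) (-(4 * r)) r := fun r => by
    refine ((((hasDerivAt_pow 2 r).const_mul 2)).const_sub (R1 ^ 2 + R2 ^ 2)).congr_deriv ?_
    simp; ring
  have hn : ∀ x : EuclideanSpace ℝ (Fin 3), ∑ i, (x i : ℂ) * (x i : ℂ) = (‖x‖ : ℂ) ^ 2 := by
    intro x
    rw [← Complex.ofReal_pow, EuclideanSpace.norm_sq_eq, Fin.sum_univ_three, Fin.sum_univ_three]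
    simp [sq]
  have hcW : Continuous fun x : EuclideanSpace ℝ (Fin 3) => shellWeight R1 R2 ‖x‖ :=
    (continuous_shellWeight R1 R2).comp continuous_norm
  have hcD : Continuous fun x : EuclideanSpace ℝ (Fin 3) =>
      3 * shellWeight R1 R2 ‖x‖ - 4 * ‖x‖ ^ 2 := by fun_prop
  have hint : ∀ {f : EuclideanSpace ℝ (Fin 3) → ℝ}, Continuous f →
      IntegrableOn f (shell R1 R2) := fun hf =>
    (hf.continuousOn.integrableOn_compact (isCompact_closure_shell R1 R2)).mono_set subset_closure
  have hχ : Continuous fun x : EuclideanSpace ℝ (Fin 3) => cutoff R1 R2 ε ‖x‖ :=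
    (continuous_cutoff R1 R2 ε).comp continuous_norm
  have key := setIntegral_cutoff_divergence (V := fld (shellWeight R1 R2) (radP 1))
    (D := fun x => ((3 * shellWeight R1 R2 ‖x‖ - 4 * ‖x‖ ^ 2 : ℝ) : ℂ)) hR1 hR hε
    ((continuousOn_fld (continuous_shellWeight R1 R2).continuousOn _).mono
      (closure_shell_ne_zero hR1)) (Complex.continuous_ofReal.comp hcD).continuousOn
    (fun x hx i => (hasFDerivAt_fld (shell_ne_zero hR1 hx) (hW _) _ i).differentiableAt)
    (fun x hx => ?_)
  · have e : ∀ x : EuclideanSpace ℝ (Fin 3), ((cutoffSlope R1 R2 ε ‖x‖ *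
        (2 * (R1 ^ 2 + R2 ^ 2 - 2 * ‖x‖ ^ 2)) : ℝ) : ℂ) *
          ∑ i, (x i : ℂ) * fld (shellWeight R1 R2) (radP 1) x i =
        ((cutoffSlope R1 R2 ε ‖x‖ * (2 * shellWeight R1 R2 ‖x‖ ^ 2 * ‖x‖ ^ 2) : ℝ) : ℂ) := by
      intro x
      have : ∑ i, (x i : ℂ) * fld (shellWeight R1 R2) (radP 1) x i =
          shellWeight R1 R2 ‖x‖ * (‖x‖ : ℂ) ^ 2 := by
        rw [← hn, Finset.mul_sum]
        refine Finset.sum_congr rfl fun i _ => ?_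
        simp [fld, radP, ev]
        ring
      rw [this, ← shellWeight]
      push_cast
      ring
    simp only [e, ← Complex.ofReal_mul] at key
    rw [integral_complex_ofReal, integral_complex_ofReal, ← Complex.ofReal_neg,
      Complex.ofReal_inj] at key
    rw [eq_neg_iff_add_eq_zero, add_comm, ← eq_neg_iff_add_eq_zero] at key
    rw [key, ← integral_neg]
    refine setIntegral_mono (hint (hχ.mul hcD)).neg (hint hcD.abs) fun x => ?_
    calc -(cutoff R1 R2 ε ‖x‖ * (3 * shellWeight R1 R2 ‖x‖ - 4 * ‖x‖ ^ 2))
        ≤ |cutoff R1 R2 ε ‖x‖ * (3 * shellWeight R1 R2 ‖x‖ - 4 * ‖x‖ ^ 2)| := neg_le_abs _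
      _ ≤ 1 * |3 * shellWeight R1 R2 ‖x‖ - 4 * ‖x‖ ^ 2| := by
        rw [abs_mul]
        gcongr
        rw [abs_of_nonneg (show 0 ≤ cutoff R1 R2 ε ‖x‖ from Real.smoothTransition.nonneg _)]
        exact Real.smoothTransition.le_one _
      _ = _ := one_mul _
  · have hx0 := shell_ne_zero hR1 hx
    simp only [dvg, pd_eq_of_hasFDerivAt (hasFDerivAt_fld hx0 (hW _) _ _)]
    have h3 := hn x
    rw [Fin.sum_univ_three] at h3 ⊢
    have hx1 : (‖x‖ : ℂ) ≠ 0 := by exact_mod_cast norm_ne_zero_iff.2 hx0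
    simp [radP, ev, MvPolynomial.pderiv_X]
    field_simp
    linear_combination -4 * h3

/-- The divergence theorem in the shell for a field with vanishing normal component. -/
theorem setIntegral_divergence_eq_zero {R1 R2 : ℝ} (hR1 : 0 < R1) (hR : R1 < R2)
    {V : EuclideanSpace ℝ (Fin 3) → Fin 3 → ℂ} {D : EuclideanSpace ℝ (Fin 3) → ℂ}
    (hV : ContinuousOn V (closure (shell R1 R2))) (hD : ContinuousOn D (closure (shell R1 R2)))
    (hd : ∀ x ∈ shell R1 R2, ∀ i, DifferentiableAt ℝ (fun z => V z i) x)
    (hdiv : ∀ x ∈ shell R1 R2, dvg V x = D x)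
    (hbd : ∀ x : EuclideanSpace ℝ (Fin 3), ‖x‖ = R1 ∨ ‖x‖ = R2 →
      ∑ i, (x i : ℂ) * V x i = 0) :
    ∫ x in shell R1 R2, D x = 0 := by
  have hSm : MeasurableSet (shell R1 R2) := (isOpen_shell R1 R2).measurableSet
  have hxc : ContinuousOn (fun x : EuclideanSpace ℝ (Fin 3) => ∑ i, (x i : ℂ) * V x i)
      (closure (shell R1 R2)) :=
    continuousOn_finsetSum _ fun i _ => ContinuousOn.mul
      (Complex.continuous_ofReal.comp (by fun_prop)).continuousOn (continuousOn_pi.1 hV i)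
  have hlim : Filter.Tendsto
      (fun ε => ∫ x in shell R1 R2, (cutoff R1 R2 ε ‖x‖ : ℂ) * D x)
      (nhdsWithin 0 (Set.Ioi 0)) (nhds (∫ x in shell R1 R2, D x)) := by
    refine tendsto_integral_filter_of_dominated_convergence (fun x => ‖D x‖)
      (Filter.Eventually.of_forall fun ε => ?_) (Filter.Eventually.of_forall fun ε =>
      Filter.Eventually.of_forall fun x => ?_) hD.integrableOn_shell.norm ?_
    · exact (((Complex.continuous_ofReal.comp
        ((continuous_cutoff R1 R2 ε).comp continuous_norm)).continuousOn.mul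
          hD).integrableOn_shell).aestronglyMeasurable
    · rw [norm_mul, Complex.norm_real, Real.norm_of_nonneg (show 0 ≤ cutoff R1 R2 ε ‖x‖ from
        Real.smoothTransition.nonneg _)]
      exact mul_le_of_le_one_left (norm_nonneg _) (Real.smoothTransition.le_one _)
    · refine (ae_restrict_iff' hSm).2 (Filter.Eventually.of_forall fun x hx => ?_)
      have hb := bump_pos hR1 hx
      refine tendsto_nhds_of_eventually_eq ?_
      filter_upwards [Ioo_mem_nhdsGT (half_pos hb)] with ε hε
      have : cutoff R1 R2 ε ‖x‖ = 1 := by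
        refine Real.smoothTransition.one_of_one_le ?_
        rw [le_sub_iff_add_le, le_div_iff₀ hε.1]
        linarith [hε.2]
      simp [this]
  set C := ∫ x in shell R1 R2, |3 * shellWeight R1 R2 ‖x‖ - 4 * ‖x‖ ^ 2| with hC
  have hC0 : 0 ≤ C := integral_nonneg fun x => abs_nonneg _
  have hL : 0 < R2 ^ 2 - R1 ^ 2 := by nlinarith
  have hsmall : ∀ η, 0 < η → ∀ᶠ ε in nhdsWithin (0 : ℝ) (Set.Ioi 0),
      ‖∫ x in shell R1 R2, (cutoff R1 R2 ε ‖x‖ : ℂ) * D x‖ ≤ η * C := by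
    intro η hη
    obtain ⟨δ, hδ, hδw⟩ := exists_bump_lt_imp_lt hR1 hxc hbd
      (η := η * ((R2 ^ 2 - R1 ^ 2) / 2) * R1 ^ 2) (by positivity)
    have hδ' : 0 < min (δ / 2) (3 * (R2 ^ 2 - R1 ^ 2) ^ 2 / 32) := by positivity
    filter_upwards [Ioo_mem_nhdsGT hδ'] with ε hε
    obtain ⟨hε0, hε1⟩ := hε
    rw [lt_min_iff] at hε1
    rw [setIntegral_cutoff_divergence hR1 hR hε0 hV hD hd hdiv, norm_neg]
    refine le_trans ?_ (mul_le_mul_of_nonneg_left (setIntegral_cutoffSlope_le hR1 hR hε0) hη.le)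
    rw [← integral_const_mul]
    have hcont : Continuous fun x : EuclideanSpace ℝ (Fin 3) => η * (cutoffSlope R1 R2 ε ‖x‖ *
        (2 * shellWeight R1 R2 ‖x‖ ^ 2 * ‖x‖ ^ 2)) := by
      have h1 := (continuous_cutoffSlope R1 R2 ε).comp
        (continuous_norm (E := EuclideanSpace ℝ (Fin 3)))
      have h2 := (continuous_shellWeight R1 R2).comp
        (continuous_norm (E := EuclideanSpace ℝ (Fin 3)))
      exact continuous_const.mul (h1.mul ((continuous_const.mul (h2.pow 2)).mul
        (continuous_norm.pow 2)))
    refine norm_integral_le_of_norm_le ((hcont.continuousOn.integrableOn_compact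
      (isCompact_closure_shell R1 R2)).mono_set subset_closure) ?_
    refine (ae_restrict_iff' hSm).2 (Filter.Eventually.of_forall fun x hx => ?_)
    rw [← shellWeight, norm_mul, Complex.norm_real, Real.norm_eq_abs, abs_mul,
      abs_of_nonneg (cutoffSlope_nonneg R1 R2 _ hε0)]
    by_cases hb : 2 * ε < bump R1 R2 ‖x‖
    · rw [cutoffSlope_eq_zero R1 R2 _ hε0 hb]; simp
    · rw [not_lt] at hb
      have hw := (hδw x hx (by linarith [hε1.1])).le
      have hs := cutoffSlope_nonneg R1 R2 ‖x‖ hε0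
      have hm : (R2 ^ 2 - R1 ^ 2) / 2 ≤ |shellWeight R1 R2 ‖x‖| := by
        refine (le_abs_self _).trans (sq_le_sq.1 ?_)
        have : shellWeight R1 R2 ‖x‖ ^ 2 = (R2 ^ 2 - R1 ^ 2) ^ 2 - 4 * bump R1 R2 ‖x‖ := by
          unfold shellWeight bump; ring
        rw [this]
        nlinarith [hε1.2]
      have hr : R1 ^ 2 ≤ ‖x‖ ^ 2 := by
        have := (mem_shell.1 hx).1
        gcongr
      rw [abs_mul, abs_two, mul_assoc, mul_left_comm η, ← sq_abs (shellWeight R1 R2 ‖x‖)]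
      refine mul_le_mul_of_nonneg_left ?_ hs
      calc 2 * |shellWeight R1 R2 ‖x‖| * ‖∑ i, (x i : ℂ) * V x i‖
          ≤ 2 * |shellWeight R1 R2 ‖x‖| * (η * |shellWeight R1 R2 ‖x‖| * ‖x‖ ^ 2) := by
            gcongr
            exact hw.trans (by gcongr)
        _ = _ := by ring
  refine norm_le_zero_iff.1 (le_of_forall_pos_le_add fun η hη => ?_)
  have h := le_of_tendsto hlim.norm (hsmall (η / (C + 1)) (by positivity))
  refine h.trans ?_
  rw [zero_add, div_mul_eq_mul_div, div_le_iff₀ (by positivity)]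
  nlinarith

end divergenceShell

section pairing
open MeasureTheory

/-- The bilinear pairing over the shell of a vector field with `fld f W`. -/
noncomputable def shellPairing (R1 R2 : ℝ) (A : EuclideanSpace ℝ (Fin 3) → Fin 3 → ℂ) (f : ℝ → ℝ)
    (W : Fin 3 → MvPolynomial (Fin 3) ℂ) : ℂ :=
  ∫ x in shell R1 R2, ∑ i, A x i * fld f W x i

theorem continuousOn_sum_mul {s : Set (EuclideanSpace ℝ (Fin 3))}
    {A T : EuclideanSpace ℝ (Fin 3) → Fin 3 → ℂ} (hA : ContinuousOn A s) (hT : ContinuousOn T s) :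
    ContinuousOn (fun x => ∑ i, A x i * T x i) s :=
  continuousOn_finsetSum _ fun i _ => (continuousOn_pi.1 hA i).mul (continuousOn_pi.1 hT i)

variable {R1 R2 : ℝ} {A : EuclideanSpace ℝ (Fin 3) → Fin 3 → ℂ}

theorem continuousOn_fld_shell (hR1 : 0 < R1) {f : ℝ → ℝ} (hf : ContinuousOn f (Set.Ioi 0))
    (W : Fin 3 → MvPolynomial (Fin 3) ℂ) : ContinuousOn (fld f W) (closure (shell R1 R2)) :=
  (continuousOn_fld hf W).mono (closure_shell_ne_zero hR1)

theorem shellPairing_add_right (hR1 : 0 < R1) (hA : ContinuousOn A (closure (shell R1 R2)))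
    {f : ℝ → ℝ} (hf : ContinuousOn f (Set.Ioi 0)) (W W' : Fin 3 → MvPolynomial (Fin 3) ℂ) :
    shellPairing R1 R2 A f (W + W') = shellPairing R1 R2 A f W + shellPairing R1 R2 A f W' := by
  unfold shellPairing
  rw [← integral_add
    (continuousOn_sum_mul hA (continuousOn_fld_shell hR1 hf W)).integrableOn_shell
    (continuousOn_sum_mul hA (continuousOn_fld_shell hR1 hf W')).integrableOn_shell]
  refine integral_congr_ae (Filter.Eventually.of_forall fun x => ?_)
  simp only [← Finset.sum_add_distrib]
  refine Finset.sum_congr rfl fun i _ => ?_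
  simp [fld, ev]
  ring

theorem shellPairing_smul_right (f : ℝ → ℝ) (c : ℂ) (W : Fin 3 → MvPolynomial (Fin 3) ℂ) :
    shellPairing R1 R2 A f (c • W) = c * shellPairing R1 R2 A f W := by
  unfold shellPairing
  rw [← integral_const_mul]
  refine integral_congr_ae (Filter.Eventually.of_forall fun x => ?_)
  simp only [Finset.mul_sum]
  refine Finset.sum_congr rfl fun i _ => ?_
  simp [fld, ev]
  ring

theorem shellPairing_zero_right (f : ℝ → ℝ) : shellPairing R1 R2 A f 0 = 0 := by
  have := shellPairing_smul_right (R1 := R1) (R2 := R2) (A := A) f 0 0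
  simpa using this

theorem shellPairing_neg_right (f : ℝ → ℝ) (W : Fin 3 → MvPolynomial (Fin 3) ℂ) :
    shellPairing R1 R2 A f (-W) = -shellPairing R1 R2 A f W := by
  have := shellPairing_smul_right (R1 := R1) (R2 := R2) (A := A) f (-1) W
  simpa using this

theorem shellPairing_sub_right (hR1 : 0 < R1) (hA : ContinuousOn A (closure (shell R1 R2)))
    {f : ℝ → ℝ} (hf : ContinuousOn f (Set.Ioi 0)) (W W' : Fin 3 → MvPolynomial (Fin 3) ℂ) :
    shellPairing R1 R2 A f (W - W') = shellPairing R1 R2 A f W - shellPairing R1 R2 A f W' := by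
  rw [sub_eq_add_neg, shellPairing_add_right hR1 hA hf, shellPairing_neg_right, sub_eq_add_neg]

theorem shellPairing_add_left (hR1 : 0 < R1) (hA : ContinuousOn A (closure (shell R1 R2)))
    {f g : ℝ → ℝ} (hf : ContinuousOn f (Set.Ioi 0)) (hg : ContinuousOn g (Set.Ioi 0))
    (W : Fin 3 → MvPolynomial (Fin 3) ℂ) :
    shellPairing R1 R2 A (fun r => f r + g r) W =
      shellPairing R1 R2 A f W + shellPairing R1 R2 A g W := by
  unfold shellPairing
  rw [← integral_add
    (continuousOn_sum_mul hA (continuousOn_fld_shell hR1 hf W)).integrableOn_shell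
    (continuousOn_sum_mul hA (continuousOn_fld_shell hR1 hg W)).integrableOn_shell]
  refine integral_congr_ae (Filter.Eventually.of_forall fun x => ?_)
  simp only [← Finset.sum_add_distrib]
  refine Finset.sum_congr rfl fun i _ => ?_
  simp [fld]
  ring

theorem shellPairing_const_mul_left (c : ℝ) (f : ℝ → ℝ) (W : Fin 3 → MvPolynomial (Fin 3) ℂ) :
    shellPairing R1 R2 A (fun r => c * f r) W = c * shellPairing R1 R2 A f W := by
  unfold shellPairing
  rw [← integral_const_mul]
  refine integral_congr_ae (Filter.Eventually.of_forall fun x => ?_)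
  simp only [Finset.mul_sum]
  refine Finset.sum_congr rfl fun i _ => ?_
  simp [fld]
  ring

theorem shellPairing_congr (hR1 : 0 < R1) {f g : ℝ → ℝ} {W W' : Fin 3 → MvPolynomial (Fin 3) ℂ}
    (h : ∀ x : EuclideanSpace ℝ (Fin 3), x ≠ 0 → fld f W x = fld g W' x) :
    shellPairing R1 R2 A f W = shellPairing R1 R2 A g W' := by
  refine setIntegral_congr_fun (isOpen_shell R1 R2).measurableSet fun x hx => ?_
  simp only [h x (shell_ne_zero hR1 hx)]

theorem shellPairing_congr_left (hR1 : 0 < R1) {f g : ℝ → ℝ} (h : ∀ r, 0 < r → f r = g r)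
    (W : Fin 3 → MvPolynomial (Fin 3) ℂ) :
    shellPairing R1 R2 A f W = shellPairing R1 R2 A g W :=
  shellPairing_congr hR1 fun x hx => by funext i; simp [fld, h _ (norm_pos_iff.2 hx)]

theorem dvg_crossC {F G : EuclideanSpace ℝ (Fin 3) → Fin 3 → ℂ} {x : EuclideanSpace ℝ (Fin 3)}
    (hF : ∀ i, DifferentiableAt ℝ (fun z => F z i) x)
    (hG : ∀ i, DifferentiableAt ℝ (fun z => G z i) x) :
    (∀ i, DifferentiableAt ℝ (fun z => crossC (F z) (G z) i) x) ∧
    dvg (fun z => crossC (F z) (G z)) x =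
      (∑ i, G x i * curl F x i) - ∑ i, F x i * curl G x i := by
  have hm : ∀ i j, HasFDerivAt (fun z => F z i * G z j) (gradL fun l =>
      F x i * pd l (fun z => G z j) x + pd l (fun z => F z i) x * G x j) x := fun i j =>
    (hasFDerivAt_gradL_pd (hF i)).gradL_mul (hasFDerivAt_gradL_pd (hG j))
  have hs : ∀ i j i' j', HasFDerivAt (fun z => F z i * G z j - F z i' * G z j') (gradL fun l =>
      (F x i * pd l (fun z => G z j) x + pd l (fun z => F z i) x * G x j) -
      (F x i' * pd l (fun z => G z j') x + pd l (fun z => F z i') x * G x j')) x := by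
    intro i j i' j'
    refine ((hm i j).sub (hm i' j')).congr_fderiv ?_
    ext y
    simp only [gradL_apply, _root_.sub_apply, mul_sub, Finset.sum_sub_distrib]
  have e0 : (fun z => crossC (F z) (G z) 0) = fun z => F z 1 * G z 2 - F z 2 * G z 1 := rfl
  have e1 : (fun z => crossC (F z) (G z) 1) = fun z => F z 2 * G z 0 - F z 0 * G z 2 := rfl
  have e2 : (fun z => crossC (F z) (G z) 2) = fun z => F z 0 * G z 1 - F z 1 * G z 0 := rfl
  constructor
  · intro i
    fin_cases i
    · exact (hs 1 2 2 1).differentiableAt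
    · exact (hs 2 0 0 2).differentiableAt
    · exact (hs 0 1 1 0).differentiableAt
  · simp only [dvg, Fin.sum_univ_three, e0, e1, e2, pd_eq_of_hasFDerivAt (hs _ _ _ _)]
    simp [curl]
    ring

/-- `A` has curl `c • B` in the shell, both fields being continuous up to the boundary. -/
structure CurlPair (R1 R2 : ℝ) (c : ℂ) (A B : EuclideanSpace ℝ (Fin 3) → Fin 3 → ℂ) : Prop where
  cont : ContinuousOn A (closure (shell R1 R2))
  cont' : ContinuousOn B (closure (shell R1 R2))
  diff : ∀ x ∈ shell R1 R2, ∀ i, DifferentiableAt ℝ (fun z => A z i) x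
  curl_eq : ∀ x ∈ shell R1 R2, curl A x = fun i => c * B x i

/-- The tangential trace of `A` on the boundary spheres vanishes. -/
def TangentialZero (R1 R2 : ℝ) (A : EuclideanSpace ℝ (Fin 3) → Fin 3 → ℂ) : Prop :=
  ∀ x : EuclideanSpace ℝ (Fin 3), ‖x‖ = R1 ∨ ‖x‖ = R2 → crossC (fun i => (x i : ℂ)) (A x) = 0

theorem CurlPair.integral_curl {c : ℂ} {A B T S : EuclideanSpace ℝ (Fin 3) → Fin 3 → ℂ}
    (h : CurlPair R1 R2 c A B) (h' : CurlPair R1 R2 1 T S) (hR1 : 0 < R1) (hR : R1 < R2)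
    (hbd : TangentialZero R1 R2 A ∨ TangentialZero R1 R2 T) :
    ∫ x in shell R1 R2, ∑ i, A x i * S x i = c * ∫ x in shell R1 R2, ∑ i, B x i * T x i := by
  have hAS := continuousOn_sum_mul h.cont h'.cont'
  have hBT := continuousOn_sum_mul h.cont' h'.cont
  have cA := continuousOn_pi.1 h.cont
  have cT := continuousOn_pi.1 h'.cont
  have key := setIntegral_divergence_eq_zero hR1 hR (V := fun x => crossC (A x) (T x))
    (D := fun x => c * (∑ i, B x i * T x i) - ∑ i, A x i * S x i) ?_
    ((continuousOn_const.mul hBT).sub hAS)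
    (fun x hx => (dvg_crossC (h.diff x hx) (h'.diff x hx)).1) (fun x hx => ?_) (fun x hx => ?_)
  · rw [integral_sub (hBT.integrableOn_shell.const_mul c) hAS.integrableOn_shell,
      integral_const_mul, sub_eq_zero] at key
    exact key.symm
  · refine continuousOn_pi.2 fun i => ?_
    fin_cases i
    · exact ((cA 1).mul (cT 2)).sub ((cA 2).mul (cT 1))
    · exact ((cA 2).mul (cT 0)).sub ((cA 0).mul (cT 2))
    · exact ((cA 0).mul (cT 1)).sub ((cA 1).mul (cT 0))
  · rw [(dvg_crossC (h.diff x hx) (h'.diff x hx)).2, h.curl_eq x hx, h'.curl_eq x hx]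
    simp only [Fin.sum_univ_three]
    ring
  · rcases hbd with hb | hb
    · have e := hb x hx
      have e0 := congrFun e 0
      have e1 := congrFun e 1
      have e2 := congrFun e 2
      simp [crossC] at e0 e1 e2
      simp [Fin.sum_univ_three, crossC]
      linear_combination T x 0 * e0 + T x 1 * e1 + T x 2 * e2
    · have e := hb x hx
      have e0 := congrFun e 0
      have e1 := congrFun e 1
      have e2 := congrFun e 2
      simp [crossC] at e0 e1 e2
      simp [Fin.sum_univ_three, crossC]
      linear_combination -A x 0 * e0 - A x 1 * e1 - A x 2 * e2

theorem tangentialZero_fld_radP (f : ℝ → ℝ) (P : MvPolynomial (Fin 3) ℂ) :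
    TangentialZero R1 R2 (fld f (radP P)) := by
  intro x _
  funext i
  fin_cases i <;> simp [crossC, fld, radP, ev] <;> ring

theorem tangentialZero_fld {f : ℝ → ℝ} (h1 : f R1 = 0) (h2 : f R2 = 0)
    (W : Fin 3 → MvPolynomial (Fin 3) ℂ) : TangentialZero R1 R2 (fld f W) := by
  intro x hx
  have : fld f W x = 0 := fld_eq_zero (by rcases hx with hx | hx <;> rw [hx] <;> assumption) W
  funext i
  fin_cases i <;> simp [crossC, this]

theorem HasDerivAt.continuousOn_Ioi {f f' : ℝ → ℝ} (hf : ∀ r, 0 < r → HasDerivAt f (f' r) r) :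
    ContinuousOn f (Set.Ioi 0) := fun r hr => (hf r hr).continuousAt.continuousWithinAt

theorem ContinuousOn.div_id_Ioi {f : ℝ → ℝ} (hf : ContinuousOn f (Set.Ioi 0)) :
    ContinuousOn (fun r => f r / r) (Set.Ioi 0) :=
  hf.div continuousOn_id fun _ hr => ne_of_gt hr

/-- Integration by parts against a field of the form `fld f W`. -/
theorem CurlPair.shellPairing_curl {c : ℂ} {A B : EuclideanSpace ℝ (Fin 3) → Fin 3 → ℂ}
    (h : CurlPair R1 R2 c A B) (hR1 : 0 < R1) (hR : R1 < R2) {f f' : ℝ → ℝ}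
    (hf : ∀ r, 0 < r → HasDerivAt f (f' r) r) (hf' : ContinuousOn f' (Set.Ioi 0))
    (W : Fin 3 → MvPolynomial (Fin 3) ℂ)
    (hbd : TangentialZero R1 R2 A ∨ TangentialZero R1 R2 (fld f W)) :
    shellPairing R1 R2 A (fun r => f' r / r) (crossX W) + shellPairing R1 R2 A f (curlP W) =
      c * shellPairing R1 R2 B f W := by
  have cf := HasDerivAt.continuousOn_Ioi hf
  have c1 := continuousOn_fld_shell (R2 := R2) hR1 hf'.div_id_Ioi (crossX W)
  have c2 := continuousOn_fld_shell (R2 := R2) hR1 cf (curlP W)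
  have key := h.integral_curl (T := fld f W)
    (S := fun x => fld (fun r => f' r / r) (crossX W) x + fld f (curlP W) x)
    ⟨continuousOn_fld_shell hR1 cf W, c1.add c2, fun x hx i =>
      (hasFDerivAt_fld (shell_ne_zero hR1 hx)
        (hf _ (norm_pos_iff.2 (shell_ne_zero hR1 hx))) W i).differentiableAt, fun x hx => by
      rw [curl_fld (shell_ne_zero hR1 hx) (hf _ (norm_pos_iff.2 (shell_ne_zero hR1 hx))) W]
      funext i
      simp⟩ hR1 hR hbd
  unfold shellPairing
  rw [← key, ← integral_add (continuousOn_sum_mul h.cont c1).integrableOn_shell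
    (continuousOn_sum_mul h.cont c2).integrableOn_shell]
  refine integral_congr_ae (Filter.Eventually.of_forall fun x => ?_)
  simp only [← Finset.sum_add_distrib, Pi.add_apply, mul_add]

end pairing

section modes
variable {R1 R2 : ℝ} {c d : ℂ} {A B : EuclideanSpace ℝ (Fin 3) → Fin 3 → ℂ}

theorem CurlPair.shellPairing_radP (h : CurlPair R1 R2 c A B) (hR1 : 0 < R1) (hR : R1 < R2)
    {f f' : ℝ → ℝ} (hf : ∀ r, 0 < r → HasDerivAt f (f' r) r) (hf' : ContinuousOn f' (Set.Ioi 0))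
    (P : MvPolynomial (Fin 3) ℂ) :
    -shellPairing R1 R2 A f (crossX (gradP P)) = c * shellPairing R1 R2 B f (radP P) := by
  rw [← h.shellPairing_curl hR1 hR hf hf' (radP P) (Or.inr (tangentialZero_fld_radP f P)),
    crossX_radP, curlP_radP, shellPairing_zero_right, shellPairing_neg_right, zero_add]

theorem CurlPair.shellPairing_gradP (h : CurlPair R1 R2 c A B) (hR1 : 0 < R1) (hR : R1 < R2)
    {f f' : ℝ → ℝ} (hf : ∀ r, 0 < r → HasDerivAt f (f' r) r) (hf' : ContinuousOn f' (Set.Ioi 0))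
    (P : MvPolynomial (Fin 3) ℂ) (hbd : TangentialZero R1 R2 A ∨ (f R1 = 0 ∧ f R2 = 0)) :
    shellPairing R1 R2 A (fun r => f' r / r) (crossX (gradP P)) =
      c * shellPairing R1 R2 B f (gradP P) := by
  rw [← h.shellPairing_curl hR1 hR hf hf' (gradP P)
    (hbd.imp id fun h => tangentialZero_fld h.1 h.2 _), curlP_gradP, shellPairing_zero_right,
    add_zero]

theorem CurlPair.shellPairing_crossX_gradP (h : CurlPair R1 R2 d B A) (hR1 : 0 < R1)
    (hR : R1 < R2) {f f' : ℝ → ℝ} (hf : ∀ r, 0 < r → HasDerivAt f (f' r) r)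
    (hf' : ContinuousOn f' (Set.Ioi 0)) {P : MvPolynomial (Fin 3) ℂ} {n : ℕ}
    (hP : P.IsHomogeneous n) (hbd : TangentialZero R1 R2 B ∨ (f R1 = 0 ∧ f R2 = 0)) :
    n * shellPairing R1 R2 B (fun r => f' r / r) (radP P) -
      shellPairing R1 R2 B (fun r => r * f' r + (n + 1) * f r) (gradP P) +
      shellPairing R1 R2 B f (radP (lapP P)) =
      d * shellPairing R1 R2 A f (crossX (gradP P)) := by
  have cf := HasDerivAt.continuousOn_Ioi hf
  have c1 := hf'.div_id_Ioi
  have c2 : ContinuousOn (fun r => r * f' r) (Set.Ioi 0) := continuousOn_id.mul hf'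
  have c3 : ContinuousOn (fun r => ((n : ℝ) + 1) * f r) (Set.Ioi 0) := continuousOn_const.mul cf
  rw [← h.shellPairing_curl hR1 hR hf hf' (crossX (gradP P))
    (hbd.imp id fun h => tangentialZero_fld h.1 h.2 _), crossX_crossX, dotX_gradP hP,
    curlP_crossX_gradP hP, shellPairing_sub_right hR1 h.cont c1,
    shellPairing_sub_right hR1 h.cont cf, shellPairing_smul_right,
    shellPairing_add_left hR1 h.cont c2 c3]
  have e1 : radP (MvPolynomial.C (n : ℂ) * P) = (n : ℂ) • radP P := by
    funext i
    simp [radP, MvPolynomial.smul_eq_C_mul]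
    ring
  have e2 : shellPairing R1 R2 B (fun r => f' r / r) (fun i => normSqP * gradP P i) =
      shellPairing R1 R2 B (fun r => r * f' r) (gradP P) := by
    refine shellPairing_congr hR1 fun x hx => ?_
    funext i
    have hsq : ev (normSqP * gradP P i) x = (‖x‖ : ℂ) ^ 2 * ev (gradP P i) x := by
      rw [← Complex.ofReal_pow, EuclideanSpace.norm_sq_eq, Fin.sum_univ_three]
      simp [ev, normSqP]
    have hn : (‖x‖ : ℂ) ≠ 0 := by exact_mod_cast norm_ne_zero_iff.2 hx
    rw [fld, hsq, fld]
    push_cast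
    field_simp
  have e3 : shellPairing R1 R2 B (fun r => ((n : ℝ) + 1) * f r) (gradP P) =
      (n + 1) * shellPairing R1 R2 B f (gradP P) := by
    rw [shellPairing_const_mul_left]
    push_cast
    ring
  rw [e1, e2, e3, shellPairing_smul_right]
  ring

theorem CurlPair.shellPairing_eq_zero_of_radialODE (h : CurlPair R1 R2 c A B)
    (h' : CurlPair R1 R2 d B A) (hR1 : 0 < R1) (hR : R1 < R2) {k : ℝ} (hcd : c * d = k ^ 2)
    {n : ℕ} {P : MvPolynomial (Fin 3) ℂ} (hP : P.IsHomogeneous n) {f f' f'' g : ℝ → ℝ}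
    (hf : RadialODE n k g f f' f'')
    (hL : shellPairing R1 R2 B f (radP (lapP P)) = 0)
    (hA : TangentialZero R1 R2 A ∨
      (R1 * f' R1 + (n + 1) * f R1 = 0 ∧ R2 * f' R2 + (n + 1) * f R2 = 0))
    (hB : TangentialZero R1 R2 B ∨ (f R1 = 0 ∧ f R2 = 0)) :
    shellPairing R1 R2 A g (crossX (gradP P)) = 0 := by
  have cf := HasDerivAt.continuousOn_Ioi hf.deriv₁
  have cf' := HasDerivAt.continuousOn_Ioi hf.deriv₂
  have ch : ContinuousOn (fun r => r * f'' r + (n + 2) * f' r) (Set.Ioi 0) :=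
    (continuousOn_id.mul hf.cont).add (continuousOn_const.mul cf')
  have cq : ContinuousOn (fun r => (f'' r * r - f' r) / r ^ 2) (Set.Ioi 0) :=
    ((hf.cont.mul continuousOn_id).sub cf').div (continuousOn_id.pow 2)
      fun r hr => pow_ne_zero 2 (ne_of_gt hr)
  have x1 := h.shellPairing_radP hR1 hR (fun r hr => hf.hasDerivAt_div hr) cq P
  have x2 := h.shellPairing_gradP hR1 hR (fun r hr => hf.hasDerivAt_tangential hr) ch P hA
  have x3 := h'.shellPairing_crossX_gradP hR1 hR hf.deriv₁ cf' hP hB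
  rw [hL] at x3
  have e : shellPairing R1 R2 A g (crossX (gradP P)) = shellPairing R1 R2 A (fun r =>
      (n * (f' r / r) + (r * f'' r + (n + 2) * f' r) / r) + k ^ 2 * f r) (crossX (gradP P)) := by
    refine shellPairing_congr_left hR1 (fun r hr => ?_) _
    rw [← hf.ode r hr]
    field_simp
    ring
  have c1 : ContinuousOn (fun r => (n : ℝ) * (f' r / r)) (Set.Ioi 0) :=
    continuousOn_const.mul cf'.div_id_Ioi
  have c2 : ContinuousOn (fun r => n * (f' r / r) + (r * f'' r + (n + 2) * f' r) / r)
      (Set.Ioi 0) := c1.add ch.div_id_Ioi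
  have c3 : ContinuousOn (fun r => k ^ 2 * f r) (Set.Ioi 0) := continuousOn_const.mul cf
  rw [e, shellPairing_add_left hR1 h.cont c2 c3, shellPairing_add_left hR1 h.cont
      c1 ch.div_id_Ioi, shellPairing_const_mul_left,
      shellPairing_const_mul_left]
  push_cast
  linear_combination (-(n : ℂ)) * x1 + x2 - c * x3 - shellPairing R1 R2 A f (crossX (gradP P)) * hcd

/-- The boundary value problems for the radial equation of order `n` are solvable for every
continuous right-hand side. -/
def RadialSolvable (k R1 R2 : ℝ) (n : ℕ) : Prop :=
  ∀ g, ContinuousOn g (Set.Ioi 0) →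
    (∃ f f' f'', RadialODE n k g f f' f'' ∧ f R1 = 0 ∧ f R2 = 0) ∧
    (∃ f f' f'', RadialODE n k g f f' f'' ∧ R1 * f' R1 + (n + 1) * f R1 = 0 ∧
      R2 * f' R2 + (n + 1) * f R2 = 0)

theorem isHomogeneous_lapP {P : MvPolynomial (Fin 3) ℂ} {n : ℕ} (hP : P.IsHomogeneous n) :
    (lapP P).IsHomogeneous (n - 1 - 1) :=
  ((hP.pderiv.pderiv).add hP.pderiv.pderiv).add hP.pderiv.pderiv

theorem shellPairing_crossX_gradP_eq_zero (h : CurlPair R1 R2 c A B)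
    (h' : CurlPair R1 R2 d B A) (hR1 : 0 < R1) (hR : R1 < R2) {k : ℝ} (hcd : c * d = k ^ 2)
    (hk : k ≠ 0) (hA : TangentialZero R1 R2 A) (hS : ∀ n, 1 ≤ n → RadialSolvable k R1 R2 n)
    {n : ℕ} {P : MvPolynomial (Fin 3) ℂ} (hP : P.IsHomogeneous n) {g : ℝ → ℝ}
    (hg : ContinuousOn g (Set.Ioi 0)) :
    shellPairing R1 R2 A g (crossX (gradP P)) = 0 ∧
      shellPairing R1 R2 B g (crossX (gradP P)) = 0 := by
  have hcd0 : c * d ≠ 0 := by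
    rw [hcd]; exact pow_ne_zero 2 (by exact_mod_cast hk)
  induction n using Nat.strong_induction_on generalizing P g with
  | _ n ih =>
    rcases Nat.eq_zero_or_pos n with rfl | hn
    · have : crossX (gradP P) = 0 := by
        have hC := MvPolynomial.totalDegree_eq_zero_iff_eq_C.1 (Nat.le_zero.1 hP.totalDegree_le)
        have h0 : gradP P = 0 := by
          funext i
          rw [gradP, hC, MvPolynomial.pderiv_C]
          rfl
        rw [h0]
        funext i
        fin_cases i <;> simp [crossX]
      rw [this]
      exact ⟨shellPairing_zero_right _, shellPairing_zero_right _⟩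
    · obtain ⟨⟨f, f', f'', hf, hf1, hf2⟩, ⟨u, u', u'', hu, hu1, hu2⟩⟩ := hS n hn g hg
      have hL := isHomogeneous_lapP hP
      have hlt : n - 1 - 1 < n := by omega
      have v1 := h.shellPairing_radP hR1 hR hf.deriv₁
        (HasDerivAt.continuousOn_Ioi hf.deriv₂) (lapP P)
      rw [(ih _ hlt hL (HasDerivAt.continuousOn_Ioi hf.deriv₁)).1, neg_zero, eq_comm,
        mul_eq_zero, or_iff_right (left_ne_zero_of_mul hcd0)] at v1
      have v2 := h'.shellPairing_radP hR1 hR hu.deriv₁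
        (HasDerivAt.continuousOn_Ioi hu.deriv₂) (lapP P)
      rw [(ih _ hlt hL (HasDerivAt.continuousOn_Ioi hu.deriv₁)).2, neg_zero, eq_comm,
        mul_eq_zero, or_iff_right (right_ne_zero_of_mul hcd0)] at v2
      exact ⟨h.shellPairing_eq_zero_of_radialODE h' hR1 hR hcd hP hf v1 (Or.inl hA)
          (Or.inr ⟨hf1, hf2⟩),
        h'.shellPairing_eq_zero_of_radialODE h hR1 hR (by rw [mul_comm, hcd]) hP hu v2
          (Or.inr ⟨hu1, hu2⟩) (Or.inl hA)⟩

end modes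

section density
open MeasureTheory

/-- The real-valued polynomial functions on a set of `ℝ³`. -/
noncomputable def polySubalgebra (K : Set (EuclideanSpace ℝ (Fin 3))) : Subalgebra ℝ C(K, ℝ) where
  carrier := {g | ∃ Q : MvPolynomial (Fin 3) ℂ, ∀ x : K, ev Q x = (g x : ℂ)}
  mul_mem' := by
    rintro f g ⟨P, hP⟩ ⟨Q, hQ⟩
    exact ⟨P * Q, fun x => by simp [← hP, ← hQ, ev]⟩
  add_mem' := by
    rintro f g ⟨P, hP⟩ ⟨Q, hQ⟩
    exact ⟨P + Q, fun x => by simp [← hP, ← hQ, ev]⟩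
  algebraMap_mem' r := ⟨MvPolynomial.C (r : ℂ), fun x => by simp [ev]⟩

theorem polySubalgebra_separatesPoints (K : Set (EuclideanSpace ℝ (Fin 3))) :
    (polySubalgebra K).SeparatesPoints := by
  intro x y hxy
  obtain ⟨i, hi⟩ : ∃ i, x.1 i ≠ y.1 i := by
    by_contra! h
    exact hxy (Subtype.ext (PiLp.ext h))
  refine ⟨fun x => x.1 i, ⟨⟨fun x : K => x.1 i, by fun_prop⟩,
    ⟨MvPolynomial.X i, fun x => ?_⟩, rfl⟩, hi⟩
  simp [ev]

theorem eq_zero_of_forall_setIntegral_mul_re_ev {R1 R2 : ℝ} {w : EuclideanSpace ℝ (Fin 3) → ℝ}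
    (hw : ContinuousOn w (closure (shell R1 R2)))
    (h : ∀ Q : MvPolynomial (Fin 3) ℂ, (∀ x ∈ shell R1 R2, (ev Q x).im = 0) →
      ∫ x in shell R1 R2, w x * (ev Q x).re = 0) {x : EuclideanSpace ℝ (Fin 3)}
    (hx : x ∈ shell R1 R2) : w x = 0 := by
  have hK := isCompact_closure_shell R1 R2
  have : CompactSpace (closure (shell R1 R2)) := isCompact_iff_compactSpace.mp hK
  have hI : ∀ {u : EuclideanSpace ℝ (Fin 3) → ℝ}, ContinuousOn u (closure (shell R1 R2)) →
      IntegrableOn u (shell R1 R2) := fun hu =>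
    (hu.integrableOn_compact hK).mono_set subset_closure
  have hw2 : ContinuousOn (fun x => w x * w x) (closure (shell R1 R2)) := hw.mul hw
  have hle : ∀ ε > 0, ∫ x in shell R1 R2, w x * w x ≤ ε * ∫ x in shell R1 R2, |w x| := by
    intro ε hε
    obtain ⟨⟨g, Q, hQ⟩, hg⟩ :=
      ContinuousMap.exists_mem_subalgebra_near_continuous_of_separatesPoints _
        (polySubalgebra_separatesPoints (closure (shell R1 R2)))
        ((closure (shell R1 R2)).domRestrict w) hw.domRestrict ε hε
    have hQ' : ContinuousOn (fun x => w x * (ev Q x).re) (closure (shell R1 R2)) :=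
      hw.mul (Complex.continuous_re.comp (continuous_ev Q)).continuousOn
    have h0 := h Q fun x hx => by rw [hQ ⟨x, subset_closure hx⟩, Complex.ofReal_im]
    rw [← sub_zero (∫ x in shell R1 R2, w x * w x), ← h0, ← integral_sub (hI hw2) (hI hQ'),
      ← integral_const_mul]
    refine setIntegral_mono_on (hI (hw2.sub hQ')) ((hI hw.abs).const_mul ε)
      (isOpen_shell R1 R2).measurableSet fun x hx => ?_
    have h1 := hg ⟨x, subset_closure hx⟩
    have h2 : (ev Q x).re = g ⟨x, subset_closure hx⟩ := by
      rw [hQ ⟨x, subset_closure hx⟩, Complex.ofReal_re]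
    rw [h2, ← mul_sub]
    refine (le_abs_self _).trans ?_
    rw [abs_mul, mul_comm ε]
    refine mul_le_mul_of_nonneg_left ?_ (abs_nonneg _)
    rw [abs_sub_comm]
    exact h1.le
  have hzero : ∫ x in shell R1 R2, w x * w x = 0 := by
    refine le_antisymm ?_ (setIntegral_nonneg (isOpen_shell R1 R2).measurableSet
      fun x _ => mul_self_nonneg _)
    refine le_of_forall_gt_imp_ge_of_dense fun δ hδ => ?_
    set M := ∫ x in shell R1 R2, |w x|
    have hM : 0 ≤ M := setIntegral_nonneg (isOpen_shell R1 R2).measurableSet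
      fun x _ => abs_nonneg _
    refine (hle (δ / (M + 1)) (by positivity)).trans ?_
    rw [div_mul_eq_mul_div, div_le_iff₀ (by positivity)]
    nlinarith
  have hae := (setIntegral_eq_zero_iff_of_nonneg_ae
    (Filter.Eventually.of_forall fun x => mul_self_nonneg (w x)) (hI hw2)).1 hzero
  have := Measure.eqOn_open_of_ae_eq hae (isOpen_shell R1 R2) (hw2.mono subset_closure)
    continuousOn_const hx
  exact mul_self_eq_zero.1 this

theorem eq_zero_of_forall_setIntegral_mul_ev {R1 R2 : ℝ} {u : EuclideanSpace ℝ (Fin 3) → ℂ}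
    (hu : ContinuousOn u (closure (shell R1 R2)))
    (h : ∀ Q : MvPolynomial (Fin 3) ℂ, ∫ x in shell R1 R2, u x * ev Q x = 0)
    {x : EuclideanSpace ℝ (Fin 3)} (hx : x ∈ shell R1 R2) : u x = 0 := by
  have hint : ∀ Q, IntegrableOn (fun x => u x * ev Q x) (shell R1 R2) := fun Q =>
    (hu.mul (continuous_ev Q).continuousOn).integrableOn_shell
  refine Complex.ext ?_ ?_
  · refine eq_zero_of_forall_setIntegral_mul_re_ev (Complex.continuous_re.comp_continuousOn hu)
      (fun Q hQ => ?_) hx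
    have := congrArg Complex.re (h Q)
    rw [← RCLike.re_eq_complex_re, ← integral_re (hint Q)] at this
    refine Eq.trans (setIntegral_congr_fun (isOpen_shell R1 R2).measurableSet fun y hy => ?_) this
    simp [hQ y hy]
  · refine eq_zero_of_forall_setIntegral_mul_re_ev (Complex.continuous_im.comp_continuousOn hu)
      (fun Q hQ => ?_) hx
    have := congrArg Complex.im (h Q)
    rw [← RCLike.im_eq_complex_im, ← integral_im (hint Q)] at this
    refine Eq.trans (setIntegral_congr_fun (isOpen_shell R1 R2).measurableSet fun y hy => ?_) this
    simp [hQ y hy]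

end density

section completeness
variable {R1 R2 : ℝ} {A : EuclideanSpace ℝ (Fin 3) → Fin 3 → ℂ}

/-- The radial factors that are continuously differentiable and vanish on the boundary. -/
def IsDirichletFactor (R1 R2 : ℝ) (f : ℝ → ℝ) : Prop :=
  (∃ f' : ℝ → ℝ, (∀ r, 0 < r → HasDerivAt f (f' r) r) ∧ ContinuousOn f' (Set.Ioi 0)) ∧
    f R1 = 0 ∧ f R2 = 0

theorem IsDirichletFactor.continuousOn {f : ℝ → ℝ} (h : IsDirichletFactor R1 R2 f) :
    ContinuousOn f (Set.Ioi 0) := by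
  obtain ⟨⟨f', hf, -⟩, -⟩ := h
  exact HasDerivAt.continuousOn_Ioi hf

theorem IsDirichletFactor.sq_mul {f : ℝ → ℝ} (h : IsDirichletFactor R1 R2 f) :
    IsDirichletFactor R1 R2 fun r => r ^ 2 * f r := by
  have cf := h.continuousOn
  obtain ⟨⟨f', hf, hf'⟩, h1, h2⟩ := h
  refine ⟨⟨fun r => 2 * r * f r + r ^ 2 * f' r, fun r hr => ?_, ?_⟩, by simp [h1], by simp [h2]⟩
  · exact ((hasDerivAt_pow 2 r).mul (hf r hr)).congr_deriv (by simp)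
  · exact ((continuousOn_const.mul continuousOn_id).mul cf).add ((continuousOn_id.pow 2).mul hf')

theorem isDirichletFactor_bump (R1 R2 : ℝ) : IsDirichletFactor R1 R2 (bump R1 R2) :=
  ⟨⟨_, fun r _ => hasDerivAt_bump R1 R2 r, by fun_prop⟩, by simp [bump], by simp [bump]⟩

/-- The field pairs to zero with all the modes with Dirichlet radial factors. -/
structure ModesVanish (R1 R2 : ℝ) (A : EuclideanSpace ℝ (Fin 3) → Fin 3 → ℂ) : Prop where
  cont : ContinuousOn A (closure (shell R1 R2))
  crossX_gradP : ∀ {f} {n : ℕ} {P : MvPolynomial (Fin 3) ℂ}, IsDirichletFactor R1 R2 f →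
    P.IsHomogeneous n → shellPairing R1 R2 A f (crossX (gradP P)) = 0
  radP : ∀ {f} {n : ℕ} {P : MvPolynomial (Fin 3) ℂ}, IsDirichletFactor R1 R2 f →
    P.IsHomogeneous n → shellPairing R1 R2 A f (radP P) = 0
  gradP : ∀ {f} {n : ℕ} {P : MvPolynomial (Fin 3) ℂ}, IsDirichletFactor R1 R2 f →
    P.IsHomogeneous n → shellPairing R1 R2 A f (gradP P) = 0

theorem isHomogeneous_dotX {W : Fin 3 → MvPolynomial (Fin 3) ℂ} {n : ℕ}
    (h : ∀ i, (W i).IsHomogeneous n) : (dotX W).IsHomogeneous (1 + n) :=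
  (((MvPolynomial.isHomogeneous_X _ _).mul (h 0)).add
    ((MvPolynomial.isHomogeneous_X _ _).mul (h 1))).add
    ((MvPolynomial.isHomogeneous_X _ _).mul (h 2))

theorem isHomogeneous_curlP {W : Fin 3 → MvPolynomial (Fin 3) ℂ} {n : ℕ}
    (h : ∀ i, (W i).IsHomogeneous n) (i : Fin 3) : (curlP W i).IsHomogeneous (n - 1) := by
  fin_cases i <;> exact ((h _).pderiv).sub ((h _).pderiv)

theorem curlP_eq_zero {W : Fin 3 → MvPolynomial (Fin 3) ℂ} (h : ∀ i, (W i).IsHomogeneous 0) :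
    curlP W = 0 := by
  have hC : ∀ i, W i = _ := fun i =>
    MvPolynomial.totalDegree_eq_zero_iff_eq_C.1 (Nat.le_zero.1 (h i).totalDegree_le)
  have hp : ∀ i j, MvPolynomial.pderiv i (W j) = 0 := fun i j => by
    rw [hC j, MvPolynomial.pderiv_C]
  funext i
  fin_cases i <;> simp [curlP, hp]

theorem crossX_add (W W' : Fin 3 → MvPolynomial (Fin 3) ℂ) :
    crossX (W + W') = crossX W + crossX W' := by
  funext i
  fin_cases i <;> simp [crossX] <;> ring

theorem crossX_smul (c : ℂ) (W : Fin 3 → MvPolynomial (Fin 3) ℂ) :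
    crossX (c • W) = c • crossX W := by
  funext i
  fin_cases i <;> simp [crossX, smul_sub]

theorem shellPairing_normSqP_mul (hR1 : 0 < R1) (f : ℝ → ℝ)
    (W : Fin 3 → MvPolynomial (Fin 3) ℂ) :
    shellPairing R1 R2 A f (fun i => normSqP * W i) =
      shellPairing R1 R2 A (fun r => r ^ 2 * f r) W := by
  refine shellPairing_congr hR1 fun x _ => ?_
  funext i
  have hsq : ev (normSqP * W i) x = (‖x‖ : ℂ) ^ 2 * ev (W i) x := by
    rw [← Complex.ofReal_pow, EuclideanSpace.norm_sq_eq, Fin.sum_univ_three]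
    simp [ev, normSqP]
  rw [fld, hsq, fld]
  push_cast
  ring

theorem ModesVanish.shellPairing_eq_zero (h : ModesVanish R1 R2 A) (hR1 : 0 < R1) {m : ℕ}
    {W : Fin 3 → MvPolynomial (Fin 3) ℂ} (hW : ∀ i, (W i).IsHomogeneous m) {f : ℝ → ℝ}
    (hf : IsDirichletFactor R1 R2 f) : shellPairing R1 R2 A f W = 0 := by
  induction m using Nat.strong_induction_on generalizing W f with
  | _ m ih =>
    have cf := hf.continuousOn
    have hG := isHomogeneous_curlP hW
    have key : shellPairing R1 R2 A f (crossX (curlP W)) = 0 := by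
      rcases Nat.eq_zero_or_pos m with rfl | hm
      · rw [curlP_eq_zero hW]
        have : crossX (0 : Fin 3 → MvPolynomial (Fin 3) ℂ) = 0 := by
          funext i
          fin_cases i <;> simp [crossX]
        rw [this, shellPairing_zero_right]
      · have e := congrArg crossX (gradP_dotX hG)
        rw [crossX_add, crossX_smul, crossX_crossX] at e
        have e' := congrArg (shellPairing R1 R2 A f) e
        rw [h.crossX_gradP hf (isHomogeneous_dotX hG), shellPairing_add_right hR1 h.cont cf,
          shellPairing_smul_right, shellPairing_sub_right hR1 h.cont cf,
          h.radP hf (isHomogeneous_dotX (isHomogeneous_curlP hG)), shellPairing_normSqP_mul hR1,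
          ih (m - 1 - 1) (by omega) (isHomogeneous_curlP hG) hf.sq_mul, sub_zero, add_zero,
          eq_comm, mul_eq_zero] at e'
        exact e'.resolve_left (by exact_mod_cast (m - 1).succ_ne_zero)
    have e := congrArg (shellPairing R1 R2 A f) (gradP_dotX hW)
    rw [h.gradP hf (isHomogeneous_dotX hW), shellPairing_add_right hR1 h.cont cf,
      shellPairing_smul_right, key, add_zero, eq_comm, mul_eq_zero] at e
    exact e.resolve_left (by exact_mod_cast m.succ_ne_zero)

theorem ModesVanish.eq_zero (h : ModesVanish R1 R2 A) (hR1 : 0 < R1)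
    {x : EuclideanSpace ℝ (Fin 3)} (hx : x ∈ shell R1 R2) : A x = 0 := by
  have hb := isDirichletFactor_bump R1 R2
  have hall : ∀ (i : Fin 3) (Q : MvPolynomial (Fin 3) ℂ),
      shellPairing R1 R2 A (bump R1 R2) (Pi.single i Q) = 0 := by
    intro i Q
    induction Q using MvPolynomial.induction_on' with
    | monomial s a =>
      refine h.shellPairing_eq_zero hR1 (m := s.degree) (fun j => ?_) hb
      rcases eq_or_ne j i with rfl | hj
      · rw [Pi.single_eq_same]
        exact MvPolynomial.isHomogeneous_monomial a rfl
      · rw [Pi.single_eq_of_ne hj]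
        exact MvPolynomial.isHomogeneous_zero _ _ _
    | add p q hp hq =>
      rw [Pi.single_add, shellPairing_add_right hR1 h.cont hb.continuousOn, hp, hq, add_zero]
  funext i
  have hu : ContinuousOn (fun y : EuclideanSpace ℝ (Fin 3) => A y i * (bump R1 R2 ‖y‖ : ℂ))
      (closure (shell R1 R2)) :=
    (continuousOn_pi.1 h.cont i).mul
      (Complex.continuous_ofReal.comp ((continuous_bump R1 R2).comp continuous_norm)).continuousOn
  have h0 := eq_zero_of_forall_setIntegral_mul_ev hu (fun Q => ?_) hx
  · exact (mul_eq_zero.1 h0).resolve_right (by exact_mod_cast (bump_pos hR1 hx).ne')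
  · rw [← hall i Q]
    refine MeasureTheory.integral_congr_ae (Filter.Eventually.of_forall fun y => ?_)
    simp only [fld]
    rw [Finset.sum_eq_single i]
    · rw [Pi.single_eq_same, mul_assoc]
    · intro j _ hj
      simp [Pi.single_eq_of_ne hj, ev]
    · simp

theorem CurlPair.modesVanish {c : ℂ} {B : EuclideanSpace ℝ (Fin 3) → Fin 3 → ℂ}
    (h : CurlPair R1 R2 c A B) (hR1 : 0 < R1) (hR : R1 < R2) (hc : c ≠ 0)
    (hM : ∀ {n : ℕ} {P : MvPolynomial (Fin 3) ℂ} {g : ℝ → ℝ}, P.IsHomogeneous n →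
      ContinuousOn g (Set.Ioi 0) → shellPairing R1 R2 A g (crossX (gradP P)) = 0 ∧
        shellPairing R1 R2 B g (crossX (gradP P)) = 0) : ModesVanish R1 R2 B where
  cont := h.cont'
  crossX_gradP hf hP := (hM hP hf.continuousOn).2
  radP {_ _ P} hf hP := by
    have cf := hf.continuousOn
    obtain ⟨⟨f', h1, h2⟩, -⟩ := hf
    have := h.shellPairing_radP hR1 hR h1 h2 P
    rw [(hM hP cf).1, neg_zero, eq_comm, mul_eq_zero] at this
    exact this.resolve_left hc
  gradP {_ _ P} hf hP := by
    obtain ⟨⟨f', h1, h2⟩, h3⟩ := hf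
    have := h.shellPairing_gradP hR1 hR h1 h2 P (Or.inr h3)
    rw [(hM hP h2.div_id_Ioi).1, eq_comm, mul_eq_zero] at this
    exact this.resolve_left hc

theorem not_isMaxwellEigenvalue {k : ℝ} (hk : 0 < k) (hR1 : 0 < R1) (hR : R1 < R2)
    (hS : ∀ n, 1 ≤ n → RadialSolvable k R1 R2 n) : ¬ IsMaxwellEigenvalue k R1 R2 := by
  rintro ⟨E, H, cE, cH, dE, dH, curlE, curlH, hbd, hne⟩
  have hk' : (k : ℂ) ≠ 0 := by exact_mod_cast hk.ne'
  have h : CurlPair R1 R2 (I * k) E H := ⟨cE, cH, dE, curlE⟩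
  have h' : CurlPair R1 R2 (-(I * k)) H E := ⟨cH, cE, dH, curlH⟩
  have hcd : I * k * -(I * k) = (k : ℂ) ^ 2 := by
    linear_combination (-(k : ℂ) ^ 2) * I_sq
  have hM := fun {n : ℕ} {P : MvPolynomial (Fin 3) ℂ} {g : ℝ → ℝ} (hP : P.IsHomogeneous n)
    (hg : ContinuousOn g (Set.Ioi 0)) =>
    shellPairing_crossX_gradP_eq_zero h h' hR1 hR hcd hk.ne' hbd hS hP hg
  have mH := h.modesVanish hR1 hR (mul_ne_zero I_ne_zero hk') hM
  have mE := h'.modesVanish hR1 hR (neg_ne_zero.2 (mul_ne_zero I_ne_zero hk'))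
    fun hP hg => (hM hP hg).symm
  exact hne fun x hx => ⟨mE.eq_zero hR1 hx, mH.eq_zero hR1 hx⟩

end completeness

/-- If the boundary functionals are degenerate on two homogeneous solutions with nonvanishing
Wronskian, there is a nontrivial homogeneous solution satisfying both boundary conditions. -/
theorem exists_radialODE_boundary_of_det_eq_zero {n : ℕ} {k R1 R2 : ℝ} (hR1 : 0 < R1)
    (hR : R1 < R2) {u u' u'' v v' v'' : ℝ → ℝ}
    (hu : RadialODE n k (fun _ => 0) u u' u'') (hv : RadialODE n k (fun _ => 0) v v' v'')
    (hw : ∀ r, 0 < r → u r * v' r - u' r * v r ≠ 0) (p q : ℝ → ℝ)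
    (hdet : (p R1 * u R1 + q R1 * u' R1) * (p R2 * v R2 + q R2 * v' R2) -
      (p R1 * v R1 + q R1 * v' R1) * (p R2 * u R2 + q R2 * u' R2) = 0) :
    ∃ f f' f'', RadialODE n k (fun _ => 0) f f' f'' ∧ (∃ r, R1 < r ∧ r < R2 ∧ f r ≠ 0) ∧
      p R1 * f R1 + q R1 * f' R1 = 0 ∧ p R2 * f R2 + q R2 * f' R2 = 0 := by
  obtain ⟨y, hy0, hy⟩ := (Matrix.exists_mulVec_eq_zero_iff
    (M := !![p R1 * u R1 + q R1 * u' R1, p R1 * v R1 + q R1 * v' R1;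
      p R2 * u R2 + q R2 * u' R2, p R2 * v R2 + q R2 * v' R2])).2 (by
        rw [Matrix.det_fin_two_of, hdet])
  have h1 := congrFun hy 0
  have h2 := congrFun hy 1
  simp only [Matrix.mulVec, dotProduct, Fin.sum_univ_two, Matrix.of_apply, Matrix.cons_val',
    Matrix.cons_val_zero, Matrix.cons_val_one, Matrix.cons_val_fin_one, Pi.zero_apply] at h1 h2
  have hd : ∀ r, 0 < r →
      HasDerivAt (fun r => y 0 * u r + y 1 * v r) (y 0 * u' r + y 1 * v' r) r := fun r hr =>
    ((hu.deriv₁ r hr).const_mul _).add ((hv.deriv₁ r hr).const_mul _)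
  refine ⟨fun r => y 0 * u r + y 1 * v r, fun r => y 0 * u' r + y 1 * v' r,
    fun r => y 0 * u'' r + y 1 * v'' r, ⟨hd, fun r hr =>
      ((hu.deriv₂ r hr).const_mul _).add ((hv.deriv₂ r hr).const_mul _),
      (continuousOn_const.mul hu.cont).add (continuousOn_const.mul hv.cont), fun r hr => ?_⟩,
    ?_, by linear_combination h1, by linear_combination h2⟩
  · linear_combination y 0 * hu.ode r hr + y 1 * hv.ode r hr
  · by_contra! h
    obtain ⟨r, hr1, hr2⟩ := exists_between hR
    have hr := hR1.trans hr1
    have e0 := h r hr1 hr2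
    have e1 : y 0 * u' r + y 1 * v' r = 0 := by
      refine (hd r hr).unique ((hasDerivAt_const r (0 : ℝ)).congr_of_eventuallyEq ?_)
      filter_upwards [Ioo_mem_nhds hr1 hr2] with s hs using h s hs.1 hs.2
    have a0 : y 0 * (u r * v' r - u' r * v r) = 0 := by linear_combination v' r * e0 - v r * e1
    have a1 : y 1 * (u r * v' r - u' r * v r) = 0 := by linear_combination u r * e1 - u' r * e0
    refine hy0 (funext fun i => ?_)
    fin_cases i
    · exact (mul_eq_zero.1 a0).resolve_right (hw r hr)
    · exact (mul_eq_zero.1 a1).resolve_right (hw r hr)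

theorem radialFactor_wronskian_ne_zero {k : ℝ} (hk : 0 < k) (n : ℕ) {r : ℝ} (hr : 0 < r) :
    radialFactor sphJ n k r * radialFactorDeriv sphY n k r -
      radialFactorDeriv sphJ n k r * radialFactor sphY n k r ≠ 0 := by
  have e : radialFactor sphJ n k r * radialFactorDeriv sphY n k r -
      radialFactorDeriv sphJ n k r * radialFactor sphY n k r = k / (k * r) ^ 2 / (r ^ n) ^ 2 := by
    have h := sphJ_sphY_wronskian n (k * r) (by positivity)
    simp only [radialFactor, radialFactorDeriv]
    rw [show k / (k * r) ^ 2 = -k * -(1 / (k * r) ^ 2) by ring, ← h]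
    field_simp
    ring
  rw [e]
  positivity

theorem radialFactor_impedance {z : ℕ → ℝ → ℝ} {k : ℝ} (hk : 0 < k)
    (hz : ∀ n t, 0 < t → HasDerivAt (z n) (n / t * z n t - z (n + 1) t) t) (n : ℕ) {r : ℝ}
    (hr : 0 < r) : ((n : ℝ) + 1) * radialFactor z n k r + r * radialFactorDeriv z n k r =
      (z n (k * r) + k * r * deriv (z n) (k * r)) / r ^ n := by
  rw [(hz n (k * r) (by positivity)).deriv, radialFactor, radialFactorDeriv]
  field_simp
  ring

theorem stmt_8 (k R1 R2 : ℝ) (hk : 0 < k) (hR1 : 0 < R1) (hR12 : R1 < R2) :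
    ¬ IsMaxwellEigenvalue k R1 R2 ↔
      ∀ n : ℕ, 1 ≤ n →
        (sphJ n (k * R1) * sphY n (k * R2) - sphY n (k * R1) * sphJ n (k * R2) ≠ 0) ∧
        ((sphJ n (k * R1) + k * R1 * deriv (sphJ n) (k * R1)) *
            (sphY n (k * R2) + k * R2 * deriv (sphY n) (k * R2)) -
          (sphY n (k * R1) + k * R1 * deriv (sphY n) (k * R1)) *
            (sphJ n (k * R2) + k * R2 * deriv (sphJ n) (k * R2)) ≠ 0) := by
  have hR2 : 0 < R2 := hR1.trans hR12
  have hu := radialODE_radialFactor hk sphJ_rec hasDerivAt_sphJ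
  have hv := radialODE_radialFactor hk sphY_rec hasDerivAt_sphY
  have hw := fun n r (hr : 0 < r) => radialFactor_wronskian_ne_zero hk n hr
  have scale : ∀ (n : ℕ) (a b c d : ℝ), a / R1 ^ n * (b / R2 ^ n) - c / R1 ^ n * (d / R2 ^ n) =
      (a * b - c * d) / (R1 ^ n * R2 ^ n) := fun n a b c d => by ring
  have hRn : ∀ n, R1 ^ n * R2 ^ n ≠ 0 := fun n => by positivity
  have te : ∀ n, ((1 : ℝ) * radialFactor sphJ n k R1 + 0 * radialFactorDeriv sphJ n k R1) *
      (1 * radialFactor sphY n k R2 + 0 * radialFactorDeriv sphY n k R2) -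
      (1 * radialFactor sphY n k R1 + 0 * radialFactorDeriv sphY n k R1) *
      (1 * radialFactor sphJ n k R2 + 0 * radialFactorDeriv sphJ n k R2) =
      (sphJ n (k * R1) * sphY n (k * R2) - sphY n (k * R1) * sphJ n (k * R2)) /
        (R1 ^ n * R2 ^ n) := fun n => by
    rw [← scale]
    simp only [radialFactor]
    ring
  constructor
  · intro h n hn
    constructor
    · intro hdet
      obtain ⟨f, f', f'', hf, hne, h1, h2⟩ := exists_radialODE_boundary_of_det_eq_zero hR1 hR12
        (hu n) (hv n) (hw n) (fun _ => 1) (fun _ => 0) (by rw [te, hdet, zero_div])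
      exact h (isMaxwellEigenvalue_of_radialODE hn hk hR1 hf hne
        (Or.inl ⟨by simpa using h1, by simpa using h2⟩))
    · intro hdet
      obtain ⟨f, f', f'', hf, hne, h1, h2⟩ := exists_radialODE_boundary_of_det_eq_zero hR1 hR12
        (hu n) (hv n) (hw n) (fun _ => n + 1) id (by
          simp only [id, radialFactor_impedance hk hasDerivAt_sphJ n hR1,
            radialFactor_impedance hk hasDerivAt_sphJ n hR2,
            radialFactor_impedance hk hasDerivAt_sphY n hR1,
            radialFactor_impedance hk hasDerivAt_sphY n hR2]
          rw [scale, hdet, zero_div])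
      exact h (isMaxwellEigenvalue_of_radialODE hn hk hR1 hf hne
        (Or.inr ⟨by rw [add_comm]; exact h1, by rw [add_comm]; exact h2⟩))
  · refine fun h => not_isMaxwellEigenvalue hk hR1 hR12 fun n hn g hg => ⟨?_, ?_⟩
    · obtain ⟨f, f', f'', hf, h1, h2⟩ := exists_radialODE_boundary (R2 := R2) hR1
        (hu n) (hv n) (hw n) (fun _ => 1) (fun _ => 0) (by
          rw [te]
          exact div_ne_zero (h n hn).1 (hRn n)) g hg
      exact ⟨f, f', f'', hf, by simpa using h1, by simpa using h2⟩
    · obtain ⟨f, f', f'', hf, h1, h2⟩ := exists_radialODE_boundary (R2 := R2) hR1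
        (hu n) (hv n) (hw n) (fun _ => n + 1) id (by
          simp only [id, radialFactor_impedance hk hasDerivAt_sphJ n hR1,
            radialFactor_impedance hk hasDerivAt_sphJ n hR2,
            radialFactor_impedance hk hasDerivAt_sphY n hR1,
            radialFactor_impedance hk hasDerivAt_sphY n hR2]
          rw [scale]
          exact div_ne_zero (h n hn).2 (hRn n)) g hg
      exact ⟨f, f', f'', hf, by rw [add_comm]; exact h1, by rw [add_comm]; exact h2⟩
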